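/- There exists an absolute constant C > 0 such that for every odd prime p there is a square-full primitive root g modulo p with 1 ≤ g ≤ C · p^{2/3 + 3/(4√e)} · (log p)^{7} · 2^{6·ω(p−1)}. -/

import Mathlib

/-- A positive integer `n` is square-full if every prime `q` dividing `n` satisfies `q^2 ∣ n`. -/
def Squarefull (n : ℕ) : Prop := ∀ q : ℕ, q.Prime → q ∣ n → q ^ 2 ∣ n

open Polynomial in
/-- Coefficient polynomials of the `l`-th derivative of `f ^ N * u * X ^ (p * k)`, after removing the
factor `f ^ (N - l) * X ^ (p * k)`. -/
noncomputable def stepanovDeriv {F : Type*} [Field F] (f : F[X]) (N : ℕ) (u : F[X]) : ℕ → F[X]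
  | 0 => u
  | l + 1 => ((N - l : ℕ) : F[X]) * derivative f * stepanovDeriv f N u l
      + f * derivative (stepanovDeriv f N u l)

open Polynomial in
theorem natDegree_stepanovDeriv_le {F : Type*} [Field F] (f : F[X]) (N : ℕ) (u : F[X]) {m : ℕ}
    (hm : f.natDegree ≤ m) (l : ℕ) :
    (stepanovDeriv f N u l).natDegree ≤ u.natDegree + l * m := by
  induction l with
  | zero => simp [stepanovDeriv]
  | succ l ih =>
    rw [stepanovDeriv]
    have h1 : (derivative f).natDegree ≤ m := (natDegree_derivative_le f).trans (by omega)
    have h2 : (derivative (stepanovDeriv f N u l)).natDegree ≤ u.natDegree + l * m :=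
      (natDegree_derivative_le _).trans (by omega)
    have e : u.natDegree + (l + 1) * m = m + (u.natDegree + l * m) := by ring
    rw [e]
    refine natDegree_add_le_of_degree_le ?_ ?_
    · refine natDegree_mul_le_of_le ?_ ih
      refine (natDegree_mul_le).trans ?_
      rw [natDegree_natCast]; omega
    · exact natDegree_mul_le_of_le hm h2

open Polynomial in
theorem iterate_derivative_eq_stepanovDeriv {p : ℕ} [Fact p.Prime] (f u : (ZMod p)[X]) (N k : ℕ)
    (l : ℕ) (hl : l ≤ N) :
    derivative^[l] (f ^ N * u * X ^ (p * k)) =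
      f ^ (N - l) * stepanovDeriv f N u l * X ^ (p * k) := by
  induction l with
  | zero => simp [stepanovDeriv]
  | succ l ih =>
    rw [Function.iterate_succ_apply', ih (by omega), stepanovDeriv]
    have hX : derivative ((X : (ZMod p)[X]) ^ (p * k)) = 0 := by
      rw [derivative_X_pow]; simp
    obtain ⟨j, hj⟩ : ∃ j, N - l = j + 1 := ⟨N - l - 1, by omega⟩
    have hj' : N - (l + 1) = j := by omega
    rw [derivative_mul, hX, derivative_mul, hj, hj', derivative_pow_succ]
    simp only [map_add, map_natCast, map_one, Nat.cast_add, Nat.cast_one]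
    ring

open Polynomial in
/-- A nontrivial combination of monomials with distinct exponents, twisted by powers of a polynomial
not vanishing at zero, is nonzero. -/
theorem sum_pow_mul_X_pow_ne_zero {F ι : Type*} [Field F] [Fintype ι] (h : F[X])
    (h0 : h.eval 0 ≠ 0) (a n : ι → ℕ) (hn : Function.Injective n) (c : ι → F) (hc : c ≠ 0) :
    ∑ i, C (c i) * (h ^ a i * X ^ n i) ≠ 0 := by
  classical
  have hne : (Finset.univ.filter fun i => c i ≠ 0).Nonempty := by
    by_contra hcon
    rw [Finset.not_nonempty_iff_eq_empty, Finset.filter_eq_empty_iff] at hcon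
    exact hc (funext fun i => by simpa using hcon (Finset.mem_univ i))
  obtain ⟨i, hi, hmin⟩ := Finset.exists_min_image _ n hne
  simp only [Finset.mem_filter, Finset.mem_univ, true_and] at hi hmin
  intro hz
  have := congrArg (fun q => coeff q (n i)) hz
  simp only [finsetSum_coeff, coeff_zero, coeff_C_mul] at this
  rw [Finset.sum_eq_single i] at this
  · rw [coeff_mul_X_pow', if_pos le_rfl, Nat.sub_self, coeff_zero_eq_eval_zero, eval_pow] at this
    exact (mul_ne_zero hi (pow_ne_zero _ h0)) this
  · intro j _ hj
    by_cases hcj : c j = 0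
    · simp [hcj]
    · have h1 := hmin j hcj
      have h2 : n i ≠ n j := fun h => hj (hn h).symm
      rw [coeff_mul_X_pow', if_neg (by omega), mul_zero]
  · simp

open Polynomial in
theorem card_mul_le_natDegree_of_iterate_derivative {p : ℕ} [Fact p.Prime] (R : (ZMod p)[X])
    (hR : R ≠ 0) (S : Finset (ZMod p)) (M : ℕ) (hM : M < p)
    (hS : ∀ x ∈ S, ∀ l < M, (derivative^[l] R).eval x = 0) :
    S.card * M ≤ R.natDegree := by
  classical
  rcases Nat.eq_zero_or_pos M with rfl | hM0
  · simp
  have hmul : ∀ x ∈ S, M ≤ R.roots.count x := by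
    intro x hx
    rw [count_roots]
    have : M - 1 < R.rootMultiplicity x := by
      apply lt_rootMultiplicity_of_isRoot_iterate_derivative_of_mem_nonZeroDivisors hR
      · intro m hm
        exact hS x hx m (by omega)
      · rw [mem_nonZeroDivisors_iff_ne_zero, Ne, CharP.cast_eq_zero_iff (ZMod p) p,
          (Fact.out : p.Prime).dvd_factorial]
        omega
    omega
  calc S.card * M = ∑ x ∈ S, M := by simp
    _ ≤ ∑ x ∈ S, R.roots.count x := Finset.sum_le_sum hmul
    _ ≤ R.roots.card := by
      calc ∑ x ∈ S, R.roots.count x ≤ ∑ x ∈ S ∪ R.roots.toFinset, R.roots.count x :=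
            Finset.sum_le_sum_of_subset Finset.subset_union_left
        _ = R.roots.card := by
            rw [← Multiset.sum_count_eq_card (s := S ∪ R.roots.toFinset)]
            intro a ha
            exact Finset.mem_union_right _ (Multiset.mem_toFinset.2 ha)
    _ ≤ R.natDegree := card_roots' R

open Polynomial in
/-- Stepanov's method for the values of `f ^ e`, with `f` having a simple root at zero. -/
theorem stepanov_card_mul_le {p : ℕ} [Fact p.Prime] {d e m M K : ℕ} (hde : d * e = p - 1)
    (h : (ZMod p)[X]) (h0 : h.eval 0 ≠ 0) (hm : (X * h).natDegree ≤ m) (z : ZMod p)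
    (hM : M < p) (hcond : M * (e + m * M + K) < d * K * e)
    (S : Finset (ZMod p)) (hS : ∀ x ∈ S, ((X * h).eval x) ^ e = z) :
    S.card * M ≤ m * M + p * m + p * K := by
  classical
  set f : (ZMod p)[X] := X * h with hf
  have hp : p.Prime := Fact.out
  have hp2 := hp.two_le
  let ι := Fin d × Fin K × Fin e
  let D := e + m * M + K
  let N : ι → ℕ := fun i => M + i.1 * e
  let Pl : ℕ → ι → (ZMod p)[X] := fun l i =>
    C (z ^ (i.1 : ℕ)) * (X ^ (i.2.1 : ℕ) * stepanovDeriv f (N i) (X ^ (i.2.2 : ℕ)) l)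
  let Φ : (ι → ZMod p) →ₗ[ZMod p] (Fin M × Fin D → ZMod p) :=
    LinearMap.pi fun q => (lcoeff (ZMod p) (q.2 : ℕ)) ∘ₗ
      (Fintype.linearCombination (ZMod p) (Pl q.1))
  have hker : LinearMap.ker Φ ≠ ⊥ := by
    apply LinearMap.ker_ne_bot_of_finrank_lt
    rw [Module.finrank_fintype_fun_eq_card, Module.finrank_fintype_fun_eq_card]
    simp only [Fintype.card_prod, Fintype.card_fin, ι, D]
    rw [← mul_assoc]; exact hcond
  obtain ⟨c, hcker, hc⟩ := (Submodule.ne_bot_iff _).1 hker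
  have hdeg : ∀ l < M, ∀ i : ι, (Pl l i).natDegree < D := by
    intro l hl i
    have h1 := natDegree_stepanovDeriv_le f (N i) (X ^ (i.2.2 : ℕ)) hm l
    rw [natDegree_X_pow] at h1
    have h2 : (Pl l i).natDegree ≤ 0 + (i.2.1 + (i.2.2 + l * m)) := by
      refine natDegree_mul_le_of_le (natDegree_C _).le (natDegree_mul_le_of_le ?_ h1)
      rw [natDegree_X_pow]
    have h3 := i.2.1.2
    have h4 := i.2.2.2
    have h5 : l * m ≤ m * M := by rw [mul_comm]; exact Nat.mul_le_mul_left _ hl.le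
    show _ < e + m * M + K
    omega
  have hzero : ∀ l < M, ∑ i, C (c i) * Pl l i = 0 := by
    intro l hl
    ext n
    rw [coeff_zero]
    by_cases hn : n < D
    · have := congrFun (LinearMap.mem_ker.1 hcker) (⟨l, hl⟩, ⟨n, hn⟩)
      simp only [Φ, LinearMap.pi_apply, LinearMap.comp_apply, Fintype.linearCombination_apply,
        lcoeff_apply, smul_eq_C_mul, Pi.zero_apply] at this
      exact this
    · rw [finsetSum_coeff]
      refine Finset.sum_eq_zero fun i _ => ?_
      rw [coeff_C_mul, coeff_eq_zero_of_natDegree_lt, mul_zero]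
      exact (hdeg l hl i).trans_le (not_lt.1 hn)
  let R : (ZMod p)[X] :=
    ∑ i : ι, C (c i) * (f ^ (N i) * X ^ (i.2.2 : ℕ) * X ^ (p * (i.2.1 : ℕ)))
  have hRder : ∀ l < M, derivative^[l] R =
      ∑ i : ι, C (c i) * (f ^ (N i - l) * stepanovDeriv f (N i) (X ^ (i.2.2 : ℕ)) l *
        X ^ (p * (i.2.1 : ℕ))) := by
    intro l hl
    simp only [R]
    rw [iterate_derivative_sum]
    refine Finset.sum_congr rfl fun i _ => ?_
    rw [iterate_derivative_C_mul, iterate_derivative_eq_stepanovDeriv]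
    show l ≤ M + _
    omega
  have hvan : ∀ x ∈ S, ∀ l < M, (derivative^[l] R).eval x = 0 := by
    intro x hx l hl
    rw [hRder l hl, eval_finsetSum]
    have h1 := congrArg (eval x) (hzero l hl)
    rw [eval_finsetSum, eval_zero] at h1
    have h2 : ∀ i : ι, eval x (C (c i) * (f ^ (N i - l) *
        stepanovDeriv f (N i) (X ^ (i.2.2 : ℕ)) l * X ^ (p * (i.2.1 : ℕ)))) =
        (eval x f) ^ (M - l) * eval x (C (c i) * Pl l i) := by
      intro i
      have e1 : N i - l = (M - l) + e * i.1 := by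
        show M + i.1 * e - l = _
        rw [mul_comm e]; omega
      simp only [Pl, eval_mul, eval_pow, eval_C, eval_X]
      rw [e1, pow_add, pow_mul, hS x hx, pow_mul, ZMod.pow_card]
      ring
    rw [Finset.sum_congr rfl fun i _ => h2 i, ← Finset.mul_sum, h1, mul_zero]
  have hRne : R ≠ 0 := by
    have hinj : Function.Injective fun i : ι => M + i.1 * e + i.2.2 + p * i.2.1 := by
      rintro ⟨j, k, b⟩ ⟨j', k', b'⟩ heq
      simp only at heq
      have hb := b.2
      have hb' := b'.2
      have hj : (j : ℕ) * e + b < p := by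
        have : (j + 1) * e ≤ d * e := Nat.mul_le_mul_right _ j.2
        rw [add_mul] at this
        omega
      have hj' : (j' : ℕ) * e + b' < p := by
        have : (j' + 1) * e ≤ d * e := Nat.mul_le_mul_right _ j'.2
        rw [add_mul] at this
        omega
      have heq' : ((j : ℕ) * e + b) + p * k = ((j' : ℕ) * e + b') + p * k' := by omega
      have hmod := congrArg (· % p) heq'
      simp only [Nat.add_mul_mod_self_left, Nat.mod_eq_of_lt hj, Nat.mod_eq_of_lt hj'] at hmod
      have hk : (k : ℕ) = k' := by
        have : p * (k : ℕ) = p * k' := by omega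
        exact Nat.eq_of_mul_eq_mul_left hp.pos this
      have hmod2 := congrArg (· % e) hmod
      simp only [mul_comm _ e, Nat.mul_add_mod, Nat.mod_eq_of_lt hb, Nat.mod_eq_of_lt hb']
        at hmod2
      have hjj : (j : ℕ) = j' := by
        have : (j : ℕ) * e = j' * e := by omega
        exact Nat.eq_of_mul_eq_mul_right (by omega) this
      exact Prod.ext (Fin.ext hjj) (Prod.ext (Fin.ext hk) (Fin.ext hmod2))
    have := sum_pow_mul_X_pow_ne_zero h h0 N
      (fun i : ι => M + i.1 * e + i.2.2 + p * i.2.1) hinj c hc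
    convert this using 3 with i
    simp only [hf, N]
    rw [mul_pow]
    ring
  have hRdeg : R.natDegree ≤ m * M + p * m + p * K := by
    refine natDegree_sum_le_of_forall_le _ _ fun i _ => ?_
    have hj := i.1.2
    have hk := i.2.1.2
    have hb := i.2.2.2
    have h1 : (C (c i) * (f ^ (N i) * X ^ (i.2.2 : ℕ) * X ^ (p * (i.2.1 : ℕ)))).natDegree ≤
        0 + ((N i * m + i.2.2) + p * i.2.1) := by
      refine natDegree_mul_le_of_le (natDegree_C _).le (natDegree_mul_le_of_le
        (natDegree_mul_le_of_le (natDegree_pow_le_of_le _ hm) ?_) ?_) <;> rw [natDegree_X_pow]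
    refine h1.trans ?_
    have h2 : N i * m ≤ m * M + p * m := by
      have : (i.1 : ℕ) * e ≤ p := by
        have : (i.1 : ℕ) * e ≤ d * e := Nat.mul_le_mul_right _ hj.le
        omega
      simp only [N, add_mul]
      have := Nat.mul_le_mul_right m this
      rw [mul_comm m M]; omega
    have h3 : p * (i.2.1 : ℕ) + p ≤ p * K := by
      have : p * (i.2.1 + 1 : ℕ) ≤ p * K := Nat.mul_le_mul_left _ hk
      rwa [mul_add, mul_one] at this
    have h4 : (i.2.2 : ℕ) ≤ p := by
      have hd : 1 ≤ d := by omega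
      have : 1 * e ≤ d * e := Nat.mul_le_mul_right _ hd
      omega
    omega
  exact (card_mul_le_natDegree_of_iterate_derivative R hRne S M hM hvan).trans hRdeg

theorem MulChar.exists_generator_zmod {p : ℕ} [Fact p.Prime] {χ : MulChar (ZMod p) ℂ} :
    ∃ g : (ZMod p)ˣ, (∀ x, x ∈ Subgroup.zpowers g) ∧ IsPrimitiveRoot (χ (g : ZMod p)) (orderOf χ) := by
  obtain ⟨g, hg⟩ := IsCyclic.exists_generator (α := (ZMod p)ˣ)
  refine ⟨g, hg, ?_⟩
  have key : ∀ j : ℕ, χ (g : ZMod p) ^ j = 1 ↔ χ ^ j = 1 := by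
    intro j
    rw [← MulChar.pow_apply_coe]
    refine ⟨fun h => MulChar.eq_one_iff.2 fun u => ?_, fun h => by rw [h, MulChar.one_apply_coe]⟩
    obtain ⟨i, rfl⟩ := mem_powers_iff_mem_zpowers.2 (hg u)
    simp only [Units.val_pow_eq_pow_val, map_pow, h, one_pow]
  constructor
  · rw [key]; exact pow_orderOf_eq_one χ
  · intro l hl
    exact orderOf_dvd_of_pow_eq_one ((key l).1 hl)

theorem MulChar.pow_eq_of_apply_eq {p : ℕ} [Fact p.Prime] {χ : MulChar (ZMod p) ℂ} {e : ℕ}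
    (he : orderOf χ * e = p - 1) {x y : ZMod p} (hx : x ≠ 0) (hy : y ≠ 0) (h : χ x = χ y) :
    x ^ e = y ^ e := by
  obtain ⟨g, hg, hprim⟩ := MulChar.exists_generator_zmod (χ := χ)
  have hgp : g ^ (p - 1) = 1 := ZMod.units_pow_card_sub_one_eq_one p g
  have hd : 0 < orderOf χ := χ.orderOf_pos
  obtain ⟨i, hi⟩ := (mem_powers_iff_mem_zpowers).2 (hg (Units.mk0 x hx))
  obtain ⟨j, hj⟩ := (mem_powers_iff_mem_zpowers).2 (hg (Units.mk0 y hy))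
  have hi' : x = (g : ZMod p) ^ i := by simpa using congrArg Units.val hi.symm
  have hj' : y = (g : ZMod p) ^ j := by simpa using congrArg Units.val hj.symm
  rw [hi', hj', map_pow, map_pow] at h
  have hmod : i ≡ j [MOD orderOf χ] := by
    rw [hprim.eq_orderOf]
    obtain ⟨u, hu⟩ := (g.isUnit.map χ)
    rw [← hu] at h ⊢
    rw [orderOf_units]
    exact pow_eq_pow_iff_modEq.1 (Units.ext (by simpa using h))
  have hmod2 : i * e ≡ j * e [MOD p - 1] := by
    rw [← he]; exact hmod.mul_right' e
  have : g ^ (i * e) = g ^ (j * e) := by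
    rw [pow_eq_pow_iff_modEq]
    exact hmod2.of_dvd (orderOf_dvd_of_pow_eq_one hgp)
  rw [hi', hj', ← pow_mul, ← pow_mul]
  exact_mod_cast congrArg Units.val this

theorem MulChar.orderOf_dvd_sub_one {p : ℕ} [Fact p.Prime] (χ : MulChar (ZMod p) ℂ) :
    orderOf χ ∣ p - 1 := by
  apply orderOf_dvd_of_pow_eq_one
  rw [← ZMod.card_units p]
  exact χ.pow_card_eq_one

theorem MulChar.apply_pow_orderOf {p : ℕ} [Fact p.Prime] (χ : MulChar (ZMod p) ℂ) {x : ZMod p}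
    (hx : x ≠ 0) : χ x ^ orderOf χ = 1 := by
  lift x to (ZMod p)ˣ using hx.isUnit
  rw [← MulChar.pow_apply_coe, pow_orderOf_eq_one, MulChar.one_apply_coe]

theorem MulChar.norm_apply_eq_one {p : ℕ} [Fact p.Prime] (χ : MulChar (ZMod p) ℂ) {x : ZMod p}
    (hx : x ≠ 0) : ‖χ x‖ = 1 :=
  Complex.norm_eq_one_of_pow_eq_one (χ.apply_pow_orderOf hx) χ.orderOf_pos.ne'

theorem MulChar.norm_apply_le_one {p : ℕ} [Fact p.Prime] (χ : MulChar (ZMod p) ℂ) (x : ZMod p) :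
    ‖χ x‖ ≤ 1 := by
  by_cases hx : x = 0
  · rw [hx, MulChar.map_zero]; simp
  · exact (χ.norm_apply_eq_one hx).le

theorem MulChar.conj_apply_eq_pow {p : ℕ} [Fact p.Prime] (χ : MulChar (ZMod p) ℂ)
    (hd : 2 ≤ orderOf χ) (x : ZMod p) :
    starRingEnd ℂ (χ x) = χ x ^ (orderOf χ - 1) := by
  by_cases hx : x = 0
  · rw [hx, MulChar.map_zero, map_zero, zero_pow (by omega)]
  · have h1 := χ.apply_pow_orderOf hx
    have h2 : χ x ≠ 0 := by
      intro h0
      have := χ.norm_apply_eq_one hx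
      simp [h0] at this
    apply mul_left_cancel₀ h2
    rw [Complex.mul_conj, Complex.normSq_eq_norm_sq, χ.norm_apply_eq_one hx, ← pow_succ',
      Nat.sub_add_cancel (by omega), h1]
    simp

theorem stepanov_parameters {m d t e q : ℕ} (hm1 : 1 ≤ m) (hd : 2 ≤ d) (ht : 3 * d < t)
    (he : d * e = q) (ht1 : t * t ≤ q) :
    d * t * (e + m * (d * t) + (t + 3 * m * d ^ 2)) < d * (t + 3 * m * d ^ 2) * e := by
  have e1 : d * t * (e + m * (d * t) + (t + 3 * m * d ^ 2)) =
    (d * e) * t + (m * d ^ 2 * (t * t) + d * (t * t) + m * d ^ 2 * (3 * d * t)) := by ring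
  have e2 : d * (t + 3 * m * d ^ 2) * e = (d * e) * t + 3 * (m * d ^ 2 * (d * e)) := by ring
  rw [e1, e2, he]
  have h1 : d ≤ m * d ^ 2 := by
    calc d = 1 * (d * 1) := by ring
      _ ≤ m * (d * d) := Nat.mul_le_mul hm1 (Nat.mul_le_mul_left _ (by omega))
      _ = m * d ^ 2 := by ring
  have h2 : 0 < m * d ^ 2 := by positivity
  generalize m * d ^ 2 = y at h1 h2
  have h3 : 3 * d * t < t * t := Nat.mul_lt_mul_of_pos_right ht (by omega)
  have h4 : y * (t * t) ≤ y * q := Nat.mul_le_mul_left _ ht1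
  have h5 : d * (t * t) ≤ y * q := Nat.mul_le_mul h1 ht1
  have h6 : y * (3 * d * t) < y * q := Nat.mul_lt_mul_of_pos_left (h3.trans_le ht1) h2
  omega

theorem mul_card_le_of_stepanov {m d t p N : ℕ} (hd : 2 ≤ d) (ht : 3 * d < t) (hpt : p ≤ 4 * t * t)
    (key : N * (d * t) ≤ m * (d * t) + p * m + p * (t + 3 * m * d ^ 2)) :
    d * N ≤ p + 17 * m * d ^ 2 * t := by
  have ht0 : 0 < t := by omega
  have h1 : p * m ≤ 4 * t * t * m := Nat.mul_le_mul_right _ hpt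
  have h2 : p * (3 * m * d ^ 2) ≤ 4 * t * t * (3 * m * d ^ 2) := Nat.mul_le_mul_right _ hpt
  have h3 : t * (d * N) ≤ t * (p + (m * d + 4 * t * m + 12 * t * (m * d ^ 2))) := by
    linarith
  have h4 := Nat.le_of_mul_le_mul_left h3 ht0
  have a1 : m * d ≤ m * d ^ 2 * t := by
    calc m * d = m * d * (1 * 1) := by ring
      _ ≤ m * d * (d * t) := Nat.mul_le_mul_left _ (Nat.mul_le_mul (by omega) (by omega))
      _ = m * d ^ 2 * t := by ring
  have a2 : m * t ≤ m * d ^ 2 * t := by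
    calc m * t = m * (1 * 1) * t := by ring
      _ ≤ m * (d * d) * t := by gcongr <;> omega
      _ = m * d ^ 2 * t := by ring
  linarith

open Polynomial in
/-- The Weil bound, up to the dependence on the order of the character and the degree, for
polynomials with a simple root at zero. -/
theorem norm_sum_mulChar_eval_le {p : ℕ} [Fact p.Prime] (χ : MulChar (ZMod p) ℂ)
    (hd : 2 ≤ orderOf χ) (h : (ZMod p)[X]) (h0 : h.eval 0 ≠ 0) {m : ℕ} (hm1 : 1 ≤ m)
    (hm : (X * h).natDegree ≤ m) (ht : 3 * orderOf χ < Nat.sqrt (p - 1)) :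
    ‖∑ x, χ ((X * h).eval x)‖ ≤ 18 * m * orderOf χ ^ 2 * Nat.sqrt (p - 1) := by
  classical
  have hp : p.Prime := Fact.out
  have hp2 := hp.two_le
  obtain ⟨g, hg, hprim⟩ := MulChar.exists_generator_zmod (χ := χ)
  obtain ⟨e, he⟩ := χ.orderOf_dvd_sub_one
  set d := orderOf χ with hddef
  set t := Nat.sqrt (p - 1) with htdef
  have : NeZero d := ⟨by omega⟩
  set f : (ZMod p)[X] := X * h with hf
  set w := χ (g : ZMod p) with hw
  have ht1 : t * t ≤ p - 1 := Nat.sqrt_le _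
  have ht2 : p - 1 < (t + 1) * (t + 1) := Nat.lt_succ_sqrt _
  let A : ℕ → Finset (ZMod p) := fun i => Finset.univ.filter fun x => χ (f.eval x) = w ^ i
  have hw0 : w ≠ 0 := hprim.ne_zero (by omega)
  have hpt : p ≤ 4 * t * t := by
    have : (t + 1) * (t + 1) ≤ 4 * t * t := by nlinarith
    omega
  have hAcard : ∀ i, d * (A i).card ≤ p + 17 * m * d ^ 2 * t := by
    intro i
    have hS : ∀ x ∈ A i, (f.eval x) ^ e = ((g : ZMod p) ^ i) ^ e := by
      intro x hx
      have hx' : χ (f.eval x) = w ^ i := by simpa [A] using hx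
      apply MulChar.pow_eq_of_apply_eq (χ := χ) he.symm
      · intro h
        rw [h, MulChar.map_zero] at hx'
        exact pow_ne_zero _ hw0 hx'.symm
      · exact pow_ne_zero _ g.ne_zero
      · rw [hx', map_pow]
    have hdt : d * t < p := by
      have : d * t ≤ t * t := Nat.mul_le_mul_right _ (by omega)
      omega
    exact mul_card_le_of_stepanov hd ht hpt
      (stepanov_card_mul_le (M := d * t) (K := t + 3 * m * d ^ 2) he.symm h h0 hm _ hdt
        (stepanov_parameters hm1 hd ht he.symm ht1) (A i) hS)
  have hsum : ∑ x, χ (f.eval x) = ∑ i ∈ Finset.range d, w ^ i * ((A i).card : ℂ) := by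
    have h1 : ∀ x, χ (f.eval x) =
        ∑ i ∈ Finset.range d, if χ (f.eval x) = w ^ i then w ^ i else 0 := by
      intro x
      by_cases hx : f.eval x = 0
      · rw [hx, MulChar.map_zero]
        refine (Finset.sum_eq_zero fun i _ => ?_).symm
        rw [if_neg]
        exact (pow_ne_zero _ hw0).symm
      · obtain ⟨i, hi, hix⟩ := hprim.eq_pow_of_pow_eq_one (χ.apply_pow_orderOf hx)
        rw [Finset.sum_eq_single i]
        · rw [if_pos hix.symm, hix]
        · intro j hj hji
          rw [if_neg]
          intro hc
          rw [← hix] at hc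
          exact hji (hprim.pow_inj (Finset.mem_range.1 hj) hi hc.symm)
        · intro hc
          exact absurd (Finset.mem_range.2 hi) hc
    rw [Finset.sum_congr rfl fun x _ => h1 x, Finset.sum_comm]
    refine Finset.sum_congr rfl fun i _ => ?_
    rw [← Finset.sum_filter, Finset.sum_const, nsmul_eq_mul, mul_comm]
  have hgeom : ∑ i ∈ Finset.range d, w ^ i = 0 := hprim.geom_sum_eq_zero (by omega)
  set B : ℝ := (p + 17 * m * d ^ 2 * t) / d with hB
  have hd0 : (0 : ℝ) < d := by exact_mod_cast (by omega : 0 < d)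
  have hsum2 : ∑ x, χ (f.eval x) = ∑ i ∈ Finset.range d, w ^ i * (((A i).card : ℝ) - B : ℝ) := by
    rw [hsum]
    simp only [Complex.ofReal_sub, mul_sub, Finset.sum_sub_distrib, ← Finset.sum_mul, hgeom,
      zero_mul, sub_zero, Complex.ofReal_natCast]
  have hAB : ∀ i, ((A i).card : ℝ) ≤ B := by
    intro i
    rw [hB, le_div_iff₀ hd0, mul_comm]
    exact_mod_cast hAcard i
  have hwn : ‖w‖ = 1 := χ.norm_apply_eq_one g.ne_zero
  have hfne : f ≠ 0 := by
    rw [hf]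
    refine mul_ne_zero X_ne_zero ?_
    rintro rfl
    simp at h0
  have hcardsum : p ≤ (∑ i ∈ Finset.range d, (A i).card) + m := by
    have h1 : (Finset.univ : Finset (ZMod p)) ⊆
        ((Finset.range d).biUnion A) ∪ f.roots.toFinset := by
      intro x _
      by_cases hx : f.eval x = 0
      · exact Finset.mem_union_right _ (Multiset.mem_toFinset.2 ((mem_roots hfne).2 hx))
      · obtain ⟨i, hi, hix⟩ := hprim.eq_pow_of_pow_eq_one (χ.apply_pow_orderOf hx)
        refine Finset.mem_union_left _ (Finset.mem_biUnion.2 ⟨i, Finset.mem_range.2 hi, ?_⟩)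
        simp [A, hix]
    have h2 := Finset.card_le_card h1
    rw [Finset.card_univ, ZMod.card] at h2
    refine h2.trans ((Finset.card_union_le _ _).trans (Nat.add_le_add Finset.card_biUnion_le ?_))
    exact (Multiset.toFinset_card_le _).trans ((card_roots' f).trans hm)
  rw [hsum2]
  calc ‖∑ i ∈ Finset.range d, w ^ i * (((A i).card : ℝ) - B : ℝ)‖
      ≤ ∑ i ∈ Finset.range d, (B - (A i).card) := by
        refine (norm_sum_le _ _).trans (Finset.sum_le_sum fun i _ => ?_)
        rw [norm_mul, norm_pow, hwn, one_pow, one_mul, Complex.norm_real, Real.norm_eq_abs,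
          abs_of_nonpos (by linarith [hAB i])]
        linarith
    _ = d * B - ((∑ i ∈ Finset.range d, (A i).card : ℕ) : ℝ) := by
        rw [Finset.sum_sub_distrib]; simp
    _ ≤ d * B - (p - m) := by
        have : (p : ℝ) ≤ ((∑ i ∈ Finset.range d, (A i).card : ℕ) : ℝ) + m := by
          exact_mod_cast hcardsum
        linarith
    _ = 17 * m * d ^ 2 * t + m := by
        rw [hB, mul_div_cancel₀ _ hd0.ne']; ring
    _ ≤ 18 * m * d ^ 2 * t := by
        have : (m : ℝ) ≤ m * d ^ 2 * t := by
          have : m ≤ m * d ^ 2 * t := by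
            have : 0 < d ^ 2 * t := by have : 0 < t := by omega
                                       positivity
            rw [mul_assoc]
            exact Nat.le_mul_of_pos_right _ this
          exact_mod_cast this
        linarith

open Polynomial in
theorem norm_sum_prod_mulChar_le {p : ℕ} [Fact p.Prime] (χ : MulChar (ZMod p) ℂ)
    (hd : 2 ≤ orderOf χ) (ht : 3 * orderOf χ < Nat.sqrt (p - 1)) {ι : Type*} [Fintype ι]
    (z : ι → ZMod p) (s : ι → ℕ) (i : ι) (hi : s i = 1) (hz : ∀ j, j ≠ i → z j ≠ z i) :
    ‖∑ x, ∏ j, χ (x + z j) ^ s j‖ ≤ 18 * (∑ j, s j : ℕ) * orderOf χ ^ 2 * Nat.sqrt (p - 1) := by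
  classical
  set h : (ZMod p)[X] := ∏ j ∈ Finset.univ.erase i, (X + C (z j - z i)) ^ s j with hh
  have h0 : h.eval 0 ≠ 0 := by
    rw [hh, eval_prod, Finset.prod_ne_zero_iff]
    intro j hj
    simp only [eval_pow, eval_add, eval_X, eval_C, zero_add]
    exact pow_ne_zero _ (sub_ne_zero.2 (hz j (Finset.ne_of_mem_erase hj)))
  have hsum : (∑ j, s j) = 1 + ∑ j ∈ Finset.univ.erase i, s j := by
    rw [← Finset.add_sum_erase _ _ (Finset.mem_univ i), hi]
  have hdeg : (X * h).natDegree ≤ ∑ j, s j := by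
    rw [hsum]
    refine natDegree_mul_le_of_le natDegree_X_le ((natDegree_prod_le _ _).trans ?_)
    refine Finset.sum_le_sum fun j _ => ?_
    refine (natDegree_pow_le).trans ?_
    rw [natDegree_X_add_C, mul_one]
  refine le_trans (le_of_eq ?_) (norm_sum_mulChar_eval_le χ hd h h0 (by omega) hdeg ht)
  congr 1
  rw [← Equiv.sum_comp (Equiv.subRight (z i))]
  refine Finset.sum_congr rfl fun x _ => ?_
  rw [← Finset.mul_prod_erase _ _ (Finset.mem_univ i), hi, hh, eval_mul, eval_prod, map_mul,
    map_prod]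
  simp only [Equiv.subRight_apply, eval_X, eval_pow, eval_add, eval_C, map_pow, pow_one,
    sub_add_cancel]
  congr 1
  refine Finset.prod_congr rfl fun j _ => ?_
  congr 2
  ring

theorem card_filter_no_unique_value_le (r V : ℕ) :
    (Finset.univ.filter fun z : (Fin r ⊕ Fin r) → Fin V =>
      ∀ i, ∃ j, j ≠ i ∧ z j = z i).card ≤ r ^ (2 * r) * V ^ r := by
  classical
  rcases Nat.eq_zero_or_pos r with rfl | hr
  · exact (Finset.card_filter_le _ _).trans (by simp)
  let G : ((Fin r ⊕ Fin r) → Fin r) × (Fin r → Fin V) → ((Fin r ⊕ Fin r) → Fin V) :=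
    fun q => q.2 ∘ q.1
  have hsub : (Finset.univ.filter fun z : (Fin r ⊕ Fin r) → Fin V =>
      ∀ i, ∃ j, j ≠ i ∧ z j = z i) ⊆ Finset.univ.image G := by
    intro z hz
    simp only [Finset.mem_filter, Finset.mem_univ, true_and] at hz
    simp only [Finset.mem_image, Finset.mem_univ, true_and]
    have hcard : (Finset.univ.image z).card ≤ r := by
      have h1 : 2 * (Finset.univ.image z).card ≤ (Finset.univ : Finset (Fin r ⊕ Fin r)).card := by
        rw [mul_comm, Finset.card_eq_sum_card_image z Finset.univ, ← smul_eq_mul]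
        refine Finset.card_nsmul_le_sum _ _ _ fun b hb => ?_
        obtain ⟨i, -, rfl⟩ := Finset.mem_image.1 hb
        obtain ⟨j, hj, hji⟩ := hz i
        rw [Nat.succ_le_iff, Finset.one_lt_card]
        exact ⟨j, by simp [hji], i, by simp, hj⟩
      simp at h1
      omega
    obtain ⟨φ⟩ : Nonempty ((Finset.univ.image z) ↪ Fin r) :=
      Function.Embedding.nonempty_of_card_le (by rwa [Fintype.card_coe, Fintype.card_fin])
    have hi0 : Nonempty (Finset.univ.image z) :=
      ⟨⟨z (Sum.inl ⟨0, hr⟩), Finset.mem_image_of_mem _ (Finset.mem_univ _)⟩⟩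
    refine ⟨⟨fun i => φ ⟨z i, Finset.mem_image_of_mem _ (Finset.mem_univ _)⟩,
      fun k => (Function.invFun φ k).1⟩, ?_⟩
    funext i
    simp only [G, Function.comp_apply]
    rw [Function.leftInverse_invFun φ.injective]
  refine (Finset.card_le_card hsub).trans (Finset.card_image_le.trans ?_)
  simp [two_mul]

/-- Davenport–Erdős moments of short character sums. -/
theorem sum_norm_pow_mulChar_le {p : ℕ} [Fact p.Prime] (χ : MulChar (ZMod p) ℂ)
    (hd : 2 ≤ orderOf χ) (ht : 3 * orderOf χ < Nat.sqrt (p - 1)) (r V : ℕ) (hV : V ≤ p) :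
    ∑ x : ZMod p, ‖∑ v : Fin V, χ (x + (v : ℕ))‖ ^ (2 * r) ≤
      r ^ (2 * r) * V ^ r * p + V ^ (2 * r) * (18 * r * orderOf χ ^ 3 * Nat.sqrt (p - 1)) := by
  classical
  set d := orderOf χ with hddef
  set t := Nat.sqrt (p - 1) with htdef
  let s : (Fin r ⊕ Fin r) → ℕ := Sum.elim (fun _ => 1) (fun _ => d - 1)
  let s' : (Fin r ⊕ Fin r) → ℕ := Sum.elim (fun _ => d - 1) (fun _ => 1)
  have hs : ∑ i, s i = r * d := by
    simp only [s, Fintype.sum_sum_type, Sum.elim_inl, Sum.elim_inr, Finset.sum_const,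
      Finset.card_univ, Fintype.card_fin, smul_eq_mul]
    rw [← mul_add]; congr 1; omega
  have hs' : ∑ i, s' i = r * d := by
    simp only [s', Fintype.sum_sum_type, Sum.elim_inl, Sum.elim_inr, Finset.sum_const,
      Finset.card_univ, Fintype.card_fin, smul_eq_mul]
    rw [← mul_add]; congr 1; omega
  have hconj : ∀ y, starRingEnd ℂ (χ y) = χ y ^ (d - 1) := χ.conj_apply_eq_pow hd
  have hconj' : ∀ y, starRingEnd ℂ (χ y ^ (d - 1)) = χ y := fun y => by
    rw [← hconj, Complex.conj_conj]
  let T : ((Fin r ⊕ Fin r) → Fin V) → ℂ := fun z => ∑ x, ∏ j, χ (x + ((z j : ℕ) : ZMod p)) ^ s j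
  have hexp : ((∑ x : ZMod p, ‖∑ v : Fin V, χ (x + (v : ℕ))‖ ^ (2 * r) : ℝ) : ℂ) = ∑ z, T z := by
    rw [Finset.sum_comm]
    push_cast
    refine Finset.sum_congr rfl fun x _ => ?_
    rw [← Fintype.piFinset_univ,
      ← Finset.prod_univ_sum (fun _ => Finset.univ)
        (fun (i : Fin r ⊕ Fin r) (v : Fin V) => χ (x + ((v : ℕ) : ZMod p)) ^ s i)]
    rw [Fintype.prod_sum_type]
    simp only [s, Sum.elim_inl, Sum.elim_inr, pow_one, Finset.prod_const, Finset.card_univ,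
      Fintype.card_fin]
    rw [pow_mul, ← Complex.mul_conj', mul_pow, map_sum]
    simp only [hconj]
  have hcast : ∀ z : (Fin r ⊕ Fin r) → Fin V, ∀ i j, z i ≠ z j →
      (((z i : ℕ) : ZMod p)) ≠ ((z j : ℕ) : ZMod p) := by
    intro z i j hij h
    apply hij
    have h1 := congrArg ZMod.val h
    rw [ZMod.val_cast_of_lt ((z i).2.trans_le hV), ZMod.val_cast_of_lt ((z j).2.trans_le hV)] at h1
    exact Fin.ext h1
  have hgood : ∀ z : (Fin r ⊕ Fin r) → Fin V, (¬ ∀ i, ∃ j, j ≠ i ∧ z j = z i) →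
      ‖T z‖ ≤ 18 * r * d ^ 3 * t := by
    intro z hz
    push Not at hz
    obtain ⟨i, hi⟩ := hz
    have hzi : ∀ j, j ≠ i → (((z j : ℕ) : ZMod p)) ≠ ((z i : ℕ) : ZMod p) :=
      fun j hj => hcast z j i (hi j hj)
    have hfin : (18 * (r * d : ℕ) * d ^ 2 * t : ℝ) = 18 * r * d ^ 3 * t := by push_cast; ring
    rcases i with i | i
    · have := norm_sum_prod_mulChar_le χ hd ht (fun j => ((z j : ℕ) : ZMod p)) s (Sum.inl i) rfl hzi
      rw [hs, hfin] at this
      exact this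
    · have := norm_sum_prod_mulChar_le χ hd ht (fun j => ((z j : ℕ) : ZMod p)) s' (Sum.inr i) rfl hzi
      rw [hs', hfin] at this
      refine le_trans (le_of_eq ?_) this
      rw [← Complex.norm_conj, map_sum]
      congr 1
      refine Finset.sum_congr rfl fun x _ => ?_
      rw [map_prod]
      refine Finset.prod_congr rfl fun j _ => ?_
      rcases j with j | j
      · simp only [s, s', Sum.elim_inl, pow_one, hconj]
      · simp only [s, s', Sum.elim_inr, pow_one, hconj']
  have htriv : ∀ z, ‖T z‖ ≤ p := by
    intro z
    refine (norm_sum_le _ _).trans ?_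
    calc ∑ x : ZMod p, ‖∏ j, χ (x + ((z j : ℕ) : ZMod p)) ^ s j‖ ≤ ∑ x : ZMod p, (1 : ℝ) := by
          refine Finset.sum_le_sum fun x _ => ?_
          rw [norm_prod]
          refine Finset.prod_le_one (fun _ _ => norm_nonneg _) fun j _ => ?_
          rw [norm_pow]
          exact pow_le_one₀ (norm_nonneg _) (χ.norm_apply_le_one _)
      _ = p := by simp [ZMod.card]
  have hnn : 0 ≤ ∑ x : ZMod p, ‖∑ v : Fin V, χ (x + (v : ℕ))‖ ^ (2 * r) :=
    Finset.sum_nonneg fun _ _ => by positivity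
  rw [← abs_of_nonneg hnn, ← Real.norm_eq_abs, ← Complex.norm_real, hexp]
  refine (norm_sum_le _ _).trans ?_
  rw [← Finset.sum_filter_add_sum_filter_not Finset.univ
    (fun z : (Fin r ⊕ Fin r) → Fin V => ∀ i, ∃ j, j ≠ i ∧ z j = z i)]
  refine add_le_add ?_ ?_
  · refine (Finset.sum_le_card_nsmul _ _ _ fun z _ => htriv z).trans ?_
    rw [nsmul_eq_mul]
    refine mul_le_mul_of_nonneg_right ?_ (Nat.cast_nonneg _)
    exact_mod_cast card_filter_no_unique_value_le r V
  · refine (Finset.sum_le_card_nsmul _ _ _ fun z hz => hgood z (Finset.mem_filter.1 hz).2).trans ?_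
    rw [nsmul_eq_mul]
    refine mul_le_mul_of_nonneg_right ?_ (by positivity)
    have : (Finset.univ.filter fun z : (Fin r ⊕ Fin r) → Fin V =>
      ¬ ∀ i, ∃ j, j ≠ i ∧ z j = z i).card ≤ V ^ (2 * r) := by
      refine (Finset.card_filter_le _ _).trans (le_of_eq ?_)
      simp [two_mul]
    exact_mod_cast this

theorem norm_sum_Icc_sub_sum_Icc_add_le (f : ℕ → ℂ) (hf : ∀ n, ‖f n‖ ≤ 1) (H k : ℕ) :
    ‖∑ n ∈ Finset.Icc 1 H, f n - ∑ n ∈ Finset.Icc 1 H, f (n + k)‖ ≤ 2 * k := by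
  have hr : ∀ g : ℕ → ℂ, ∑ n ∈ Finset.Icc 1 H, g n = ∑ n ∈ Finset.range H, g (n + 1) := by
    intro g
    rw [Finset.range_eq_Ico, Finset.sum_Ico_add' g 0 H 1]
    rfl
  rw [hr, hr]
  induction k with
  | zero => simp
  | succ k ih =>
    have h1 := Finset.sum_range_succ' (fun n => f (n + 1 + k)) H
    have h2 := Finset.sum_range_succ (fun n => f (n + 1 + k)) H
    have h3 : ∑ n ∈ Finset.range H, f (n + 1) - ∑ n ∈ Finset.range H, f (n + 1 + (k + 1)) =
        (∑ n ∈ Finset.range H, f (n + 1) - ∑ n ∈ Finset.range H, f (n + 1 + k)) +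
          (f (0 + 1 + k) - f (H + 1 + k)) := by
      have h4 : ∑ n ∈ Finset.range H, f (n + 1 + (k + 1)) =
          ∑ n ∈ Finset.range H, f (n + 1 + 1 + k) :=
        Finset.sum_congr rfl fun n _ => by congr 1; omega
      rw [h4]
      linear_combination h1 - h2
    rw [h3]
    refine (norm_add_le _ _).trans ?_
    have h5 := (norm_sub_le (f (0 + 1 + k)) (f (H + 1 + k))).trans (add_le_add (hf _) (hf _))
    push_cast
    linarith

theorem sum_pow_two_mul_le {ι κ : Type*} [Fintype κ] [DecidableEq κ] (Q : Finset ι) (x : ι → κ)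
    (T : κ → ℝ) (hT : ∀ a, 0 ≤ T a) (r E : ℕ)
    (hE : ((Q ×ˢ Q).filter fun q => x q.1 = x q.2).card ≤ Q.card * E) :
    (∑ q ∈ Q, T (x q)) ^ (2 * (r + 1)) ≤
      (Q.card : ℝ) ^ (2 * r + 1) * E * ∑ a, T a ^ (2 * (r + 1)) := by
  let ν : κ → ℕ := fun a => (Q.filter fun q => x q = a).card
  have h1 : (∑ q ∈ Q, T (x q)) ^ (r + 1) ≤ (Q.card : ℝ) ^ r * ∑ q ∈ Q, T (x q) ^ (r + 1) := by
    rcases Q.eq_empty_or_nonempty with rfl | hQ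
    · simp
    · have h := pow_sum_div_card_le_sum_pow (s := Q) (f := fun q => T (x q))
        (n := r) (fun q _ => hT _)
      rw [div_le_iff₀ (by have := hQ.card_pos; positivity)] at h
      rw [mul_comm]
      exact h
  have h2 : ∑ q ∈ Q, T (x q) ^ (r + 1) = ∑ a, (ν a : ℝ) * T a ^ (r + 1) := by
    rw [← Finset.sum_fiberwise Q x]
    refine Finset.sum_congr rfl fun a _ => ?_
    rw [Finset.sum_congr rfl fun q hq => by rw [(Finset.mem_filter.1 hq).2]]
    rw [Finset.sum_const, nsmul_eq_mul]
  have h3 : ∑ a, (ν a : ℝ) ^ 2 ≤ Q.card * E := by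
    have : ∑ a, ν a ^ 2 = ((Q ×ˢ Q).filter fun q => x q.1 = x q.2).card := by
      rw [Finset.card_eq_sum_card_fiberwise (f := fun q => x q.1) (t := Finset.univ)
        (fun _ _ => Finset.mem_coe.2 (Finset.mem_univ _))]
      refine Finset.sum_congr rfl fun a _ => ?_
      rw [sq, ← Finset.card_product]
      congr 1
      ext ⟨q, q'⟩
      simp only [Finset.mem_product, Finset.mem_filter]
      constructor
      · rintro ⟨⟨a1, a2⟩, a3, a4⟩
        exact ⟨⟨⟨a1, a3⟩, a2.trans a4.symm⟩, a2⟩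
      · rintro ⟨⟨⟨a1, a3⟩, a2⟩, a4⟩
        exact ⟨⟨a1, a4⟩, a3, a2.symm.trans a4⟩
    exact_mod_cast this.le.trans hE
  have h4 := Finset.sum_mul_sq_le_sq_mul_sq Finset.univ (fun a => (ν a : ℝ))
    (fun a => T a ^ (r + 1))
  have hS : 0 ≤ ∑ q ∈ Q, T (x q) := Finset.sum_nonneg fun _ _ => hT _
  have h5 : ∑ a, (T a ^ (r + 1)) ^ 2 = ∑ a, T a ^ (2 * (r + 1)) :=
    Finset.sum_congr rfl fun a _ => by rw [← pow_mul, mul_comm]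
  rw [h5] at h4
  have h6 : 0 ≤ ∑ a, T a ^ (2 * (r + 1)) := Finset.sum_nonneg fun a _ => pow_nonneg (hT a) _
  calc (∑ q ∈ Q, T (x q)) ^ (2 * (r + 1)) = ((∑ q ∈ Q, T (x q)) ^ (r + 1)) ^ 2 := by
        rw [← pow_mul, mul_comm]
    _ ≤ ((Q.card : ℝ) ^ r * ∑ q ∈ Q, T (x q) ^ (r + 1)) ^ 2 := by gcongr
    _ = (Q.card : ℝ) ^ (2 * r) * (∑ a, (ν a : ℝ) * T a ^ (r + 1)) ^ 2 := by
        rw [h2, mul_pow, ← pow_mul, mul_comm r 2]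
    _ ≤ (Q.card : ℝ) ^ (2 * r) * ((Q.card * E) * ∑ a, T a ^ (2 * (r + 1))) := by
        gcongr
        exact h4.trans (mul_le_mul_of_nonneg_right h3 h6)
    _ = _ := by ring

theorem card_filter_mul_inv_eq_le {p : ℕ} [Fact p.Prime] {H U D : ℕ} (hHU : H * U < p)
    (hU : U < p) (hD : ∀ n, 1 ≤ n → n < p → n.divisors.card ≤ D) :
    (((Finset.Icc 1 H ×ˢ Finset.Icc 1 U) ×ˢ (Finset.Icc 1 H ×ˢ Finset.Icc 1 U)).filter
      fun q => (q.1.1 : ZMod p) * (q.1.2 : ZMod p)⁻¹ = (q.2.1 : ZMod p) * (q.2.2 : ZMod p)⁻¹).card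
      ≤ (Finset.Icc 1 H ×ˢ Finset.Icc 1 U).card * D := by
  rw [mul_comm]
  have key : ∀ q ∈ (((Finset.Icc 1 H ×ˢ Finset.Icc 1 U) ×ˢ
      (Finset.Icc 1 H ×ˢ Finset.Icc 1 U)).filter fun q =>
      (q.1.1 : ZMod p) * (q.1.2 : ZMod p)⁻¹ = (q.2.1 : ZMod p) * (q.2.2 : ZMod p)⁻¹),
      q.1.1 * q.2.2 = q.2.1 * q.1.2 := by
    rintro ⟨⟨n, u⟩, ⟨n', u'⟩⟩ hq
    simp only [Finset.mem_filter, Finset.mem_product, Finset.mem_Icc] at hq ⊢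
    obtain ⟨⟨⟨⟨hn1, hn2⟩, hu1, hu2⟩, ⟨hn1', hn2'⟩, hu1', hu2'⟩, heq⟩ := hq
    have hne : ∀ w, 1 ≤ w → w ≤ U → (w : ZMod p) ≠ 0 := by
      intro w hw1 hw2 h0
      rw [ZMod.natCast_eq_zero_iff] at h0
      have := Nat.le_of_dvd hw1 h0
      omega
    have h1 := hne u hu1 hu2
    have h2 := hne u' hu1' hu2'
    have h3 : ((n * u' : ℕ) : ZMod p) = ((n' * u : ℕ) : ZMod p) := by
      push_cast
      field_simp at heq
      rw [heq, mul_comm]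
    have h4 := congrArg ZMod.val h3
    rwa [ZMod.val_cast_of_lt, ZMod.val_cast_of_lt] at h4
    · exact (Nat.mul_le_mul hn2' hu2).trans_lt hHU
    · exact (Nat.mul_le_mul hn2 hu2').trans_lt hHU
  refine Finset.card_le_mul_card_image_of_maps_to (f := fun q => (q.1.1, q.2.2)) ?_ _ ?_
  · rintro ⟨⟨n, u⟩, ⟨n', u'⟩⟩ hq
    simp only [Finset.mem_filter, Finset.mem_product, Finset.mem_Icc] at hq ⊢
    tauto
  · rintro ⟨n, u'⟩ hb
    simp only [Finset.mem_product, Finset.mem_Icc] at hb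
    refine le_trans ?_ (hD (n * u') (Nat.mul_pos (by omega) (by omega))
      ((Nat.mul_le_mul hb.1.2 hb.2.2).trans_lt hHU))
    refine Finset.card_le_card_of_injOn (fun q => q.1.2) ?_ ?_
    · intro q hq
      have hq' := Finset.mem_filter.1 hq
      have h1 := key q hq'.1
      have h2 := Prod.ext_iff.1 hq'.2
      simp only at h2
      rw [h2.1, h2.2] at h1
      simp only [Finset.mem_coe, Nat.mem_divisors]
      exact ⟨Dvd.intro_left _ h1.symm, (Nat.mul_pos (by omega) (by omega)).ne'⟩
    · intro q hq q' hq' heq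
      have hqm := Finset.mem_filter.1 hq
      have hqm' := Finset.mem_filter.1 hq'
      have h1 := key q hqm.1
      have h1' := key q' hqm'.1
      have h2 := Prod.ext_iff.1 hqm.2
      have h2' := Prod.ext_iff.1 hqm'.2
      simp only at h2 h2' heq
      rw [h2.1, h2.2] at h1
      rw [h2'.1, h2'.2, ← heq] at h1'
      have hm := Finset.mem_filter.1 hqm.1
      simp only [Finset.mem_product, Finset.mem_Icc] at hm
      have h3 : q.2.1 = q'.2.1 := Nat.eq_of_mul_eq_mul_right hm.1.1.2.1 (h1.symm.trans h1')
      exact Prod.ext (Prod.ext (h2.1.trans h2'.1.symm) heq) (Prod.ext h3 (h2.2.trans h2'.2.symm))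

/-- The Burgess inequality for initial intervals. -/
theorem burgess_inequality {p : ℕ} [Fact p.Prime] (χ : MulChar (ZMod p) ℂ)
    (hd : 2 ≤ orderOf χ) (ht : 3 * orderOf χ < Nat.sqrt (p - 1)) {H U V D r : ℕ}
    (hHU : H * U < p) (hU : U < p) (hV : V ≤ p)
    (hD : ∀ n, 1 ≤ n → n < p → n.divisors.card ≤ D) :
    ∃ B : ℝ, 0 ≤ B ∧ U * V * ‖∑ n ∈ Finset.Icc 1 H, χ (n : ZMod p)‖ ≤ 2 * (U * V) ^ 2 + B ∧
      B ^ (2 * (r + 1)) ≤ (H * U) ^ (2 * r + 1) * D *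
        ((r + 1 : ℕ) ^ (2 * (r + 1)) * V ^ (r + 1) * p +
          V ^ (2 * (r + 1)) * (18 * (r + 1 : ℕ) * orderOf χ ^ 3 * Nat.sqrt (p - 1))) := by
  set S := ∑ n ∈ Finset.Icc 1 H, χ (n : ZMod p) with hS
  let Q := Finset.Icc 1 H ×ˢ Finset.Icc 1 U
  let T : ZMod p → ℝ := fun x => ‖∑ v : Fin V, χ (x + (v : ℕ))‖
  let x : ℕ × ℕ → ZMod p := fun q => (q.1 : ZMod p) * (q.2 : ZMod p)⁻¹
  refine ⟨∑ q ∈ Q, T (x q), Finset.sum_nonneg fun _ _ => norm_nonneg _, ?_, ?_⟩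
  · have hshift : ∀ u ∈ Finset.Icc 1 U, ∀ v : Fin V,
        ‖S - ∑ n ∈ Finset.Icc 1 H, χ (((n + u * v : ℕ)) : ZMod p)‖ ≤ 2 * (U * V) := by
      intro u hu v
      refine (norm_sum_Icc_sub_sum_Icc_add_le (fun n => χ (n : ZMod p))
        (fun n => χ.norm_apply_le_one _) H (u * v)).trans ?_
      have h1 : u * (v : ℕ) ≤ U * V := Nat.mul_le_mul (Finset.mem_Icc.1 hu).2 v.2.le
      have h2 : ((u * (v : ℕ) : ℕ) : ℝ) ≤ U * V := by exact_mod_cast h1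
      linarith
    have hsum : (U * V * S : ℂ) = (∑ u ∈ Finset.Icc 1 U, ∑ v : Fin V,
        (S - ∑ n ∈ Finset.Icc 1 H, χ (((n + u * v : ℕ)) : ZMod p))) +
        ∑ u ∈ Finset.Icc 1 U, ∑ v : Fin V, ∑ n ∈ Finset.Icc 1 H,
          χ (((n + u * v : ℕ)) : ZMod p) := by
      simp only [Finset.sum_sub_distrib, Finset.sum_const, Nat.card_Icc, Finset.card_univ,
        Fintype.card_fin, nsmul_eq_mul, Nat.add_sub_cancel]
      ring
    have hmain : ∀ u ∈ Finset.Icc 1 U, ‖∑ v : Fin V, ∑ n ∈ Finset.Icc 1 H,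
        χ (((n + u * v : ℕ)) : ZMod p)‖ ≤ ∑ n ∈ Finset.Icc 1 H, T (x (n, u)) := by
      intro u hu
      rw [Finset.sum_comm]
      refine (norm_sum_le _ _).trans (Finset.sum_le_sum fun n _ => ?_)
      have hu' := Finset.mem_Icc.1 hu
      have hu0 : (u : ZMod p) ≠ 0 := by
        intro h0
        rw [ZMod.natCast_eq_zero_iff] at h0
        have := Nat.le_of_dvd hu'.1 h0
        omega
      have : ∀ v : Fin V, χ (((n + u * v : ℕ)) : ZMod p) =
          χ (u : ZMod p) * χ (x (n, u) + ((v : ℕ) : ZMod p)) := by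
        intro v
        rw [← map_mul]
        congr 1
        simp only [x]
        push_cast
        field_simp
      rw [Finset.sum_congr rfl fun v _ => this v, ← Finset.mul_sum, norm_mul,
        χ.norm_apply_eq_one hu0, one_mul]
    have hnorm : U * V * ‖S‖ = ‖(U * V * S : ℂ)‖ := by simp
    rw [hnorm, hsum]
    refine (norm_add_le _ _).trans (add_le_add ?_ ?_)
    · refine (norm_sum_le_of_le _ fun u hu => norm_sum_le_of_le _ fun v _ => hshift u hu v).trans
        (le_of_eq ?_)
      simp only [Finset.sum_const, Nat.card_Icc, Finset.card_univ,
        Fintype.card_fin, nsmul_eq_mul, Nat.add_sub_cancel]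
      ring
    · refine (norm_sum_le_of_le _ hmain).trans (le_of_eq ?_)
      rw [Finset.sum_comm, Finset.sum_product]
  · have h1 := sum_pow_two_mul_le Q x T (fun _ => norm_nonneg _) r D
      (card_filter_mul_inv_eq_le hHU hU hD)
    refine h1.trans ?_
    have h2 : (Q.card : ℝ) = H * U := by simp [Q]
    rw [h2]
    refine mul_le_mul_of_nonneg_left ?_ (by positivity)
    exact sum_norm_pow_mulChar_le χ hd ht (r + 1) V hV

/-- The divisor bound. -/
theorem exists_card_divisors_le_rpow {ε : ℝ} (hε : 0 < ε) :
    ∃ C : ℝ, 0 < C ∧ ∀ n : ℕ, n ≠ 0 → (n.divisors.card : ℝ) ≤ C * (n : ℝ) ^ ε := by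
  classical
  set K : ℝ := max 1 (1 / (ε * Real.log 2)) with hK
  have hK1 : 1 ≤ K := le_max_left _ _
  have hlog2 : 0 < Real.log 2 := Real.log_pos (by norm_num)
  have hKe : 1 ≤ K * (ε * Real.log 2) := by
    have := le_max_right 1 (1 / (ε * Real.log 2))
    rw [← hK, div_le_iff₀ (by positivity)] at this
    exact this
  obtain ⟨Q, hQ⟩ := exists_nat_ge ((2 : ℝ) ^ (1 / ε))
  let c : ℕ → ℝ := fun q => if q < Q then K else 1
  have hlocal : ∀ q a : ℕ, q.Prime → ((a + 1 : ℕ) : ℝ) ≤ c q * ((q ^ a : ℕ) : ℝ) ^ ε := by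
    intro q a hq
    have hq2 : (2 : ℝ) ≤ q := by exact_mod_cast hq.two_le
    have hpow : ((q ^ a : ℕ) : ℝ) ^ ε = ((q : ℝ) ^ ε) ^ a := by
      push_cast
      rw [← Real.rpow_natCast, ← Real.rpow_mul (by positivity), mul_comm,
        Real.rpow_mul (by positivity), Real.rpow_natCast]
    rw [hpow]
    by_cases hqQ : q < Q
    · simp only [c, if_pos hqQ]
      have h1 : 1 + a * (ε * Real.log 2) ≤ ((q : ℝ) ^ ε) ^ a := by
        have h2 : Real.exp (a * (ε * Real.log 2)) ≤ ((q : ℝ) ^ ε) ^ a := by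
          rw [Real.exp_nat_mul, mul_comm, ← Real.rpow_def_of_pos (by norm_num)]
          gcongr
        have := Real.add_one_le_exp (a * (ε * Real.log 2))
        linarith
      push_cast
      have h3 : K * (1 + a * (ε * Real.log 2)) ≤ K * ((q : ℝ) ^ ε) ^ a := by gcongr
      have h4 : (a : ℝ) * 1 ≤ a * (K * (ε * Real.log 2)) := by gcongr
      nlinarith
    · simp only [c, if_neg hqQ, one_mul]
      have h1 : (2 : ℝ) ≤ (q : ℝ) ^ ε := by
        have h2 : (2 : ℝ) ^ (1 / ε) ≤ q := hQ.trans (by exact_mod_cast not_lt.1 hqQ)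
        calc (2 : ℝ) = ((2 : ℝ) ^ (1 / ε)) ^ ε := by
              rw [← Real.rpow_mul (by norm_num), one_div, inv_mul_cancel₀ hε.ne', Real.rpow_one]
          _ ≤ _ := by gcongr
      have h2 : a + 1 ≤ 2 ^ a := Nat.lt_two_pow_self
      calc ((a + 1 : ℕ) : ℝ) ≤ (2 : ℝ) ^ a := by exact_mod_cast h2
        _ ≤ _ := by gcongr
  refine ⟨K ^ Q, by positivity, fun n hn => ?_⟩
  have h1 : (n : ℝ) ^ ε = ∏ q ∈ n.primeFactors, ((q ^ n.factorization q : ℕ) : ℝ) ^ ε := by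
    rw [Real.finsetProd_rpow _ _ (fun _ _ => by positivity), ← Nat.cast_prod]
    congr 2
    exact (Nat.prod_factorization_pow_eq_self hn).symm
  rw [Nat.card_divisors hn, h1]
  push_cast
  calc ∏ q ∈ n.primeFactors, ((n.factorization q : ℝ) + 1)
      ≤ ∏ q ∈ n.primeFactors, (c q * ((q : ℝ) ^ n.factorization q) ^ ε) := by
        refine Finset.prod_le_prod (fun _ _ => by positivity) fun q hq => ?_
        have := hlocal q (n.factorization q) (Nat.prime_of_mem_primeFactors hq)
        push_cast at this
        exact this
    _ = (∏ q ∈ n.primeFactors, c q) * ∏ q ∈ n.primeFactors, ((q : ℝ) ^ n.factorization q) ^ ε :=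
        Finset.prod_mul_distrib
    _ ≤ _ := by
        refine mul_le_mul_of_nonneg_right ?_ (Finset.prod_nonneg fun _ _ => by positivity)
        rw [Finset.prod_ite, Finset.prod_const, Finset.prod_const_one, mul_one]
        refine pow_le_pow_right₀ hK1 ?_
        calc _ ≤ (Finset.range Q).card := Finset.card_le_card fun q hq => by
              simpa using (Finset.mem_filter.1 hq).2
          _ = Q := Finset.card_range Q

/-- A power saving for character sums of length `p ^ (51 / 200)`. -/
theorem exists_norm_sum_mulChar_le :
    ∃ x₀ : ℝ, 17 ≤ x₀ ∧ ∀ (p : ℕ) [Fact p.Prime] (x Y : ℝ), x₀ ≤ x → Y = x ^ 210 →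
      (p : ℝ) = Y ^ 200 → (∀ n : ℕ, 1 ≤ n → n < p → (n.divisors.card : ℝ) ≤ x) →
      ∀ χ : MulChar (ZMod p) ℂ, 2 ≤ orderOf χ → (orderOf χ : ℝ) ≤ x →
        ‖∑ n ∈ Finset.Icc 1 ⌊Y ^ 51⌋₊, χ (n : ZMod p)‖ ≤ 3 * ⌊Y ^ 51⌋₊ / x := by
  obtain ⟨C, hC⟩ : ∃ C : ℝ, C = ((99 + 1 : ℕ) : ℝ) ^ (2 * (99 + 1)) + 18 * ((99 + 1 : ℕ) : ℝ) :=
    ⟨_, rfl⟩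
  have hC1 : 1 ≤ C := by
    rw [hC]
    have : (0 : ℝ) ≤ ((99 + 1 : ℕ) : ℝ) ^ (2 * (99 + 1)) := by positivity
    push_cast at this ⊢
    linarith
  refine ⟨17 + 16 * C, by linarith, ?_⟩
  intro p hpF x Y hx hYx hpY hdiv χ hd hdx
  have hx17 : 17 ≤ x := by linarith
  have hx1 : 1 ≤ x := by linarith
  have hx0 : 0 < x := by linarith
  have hYge : ∀ k ≤ 210, x ^ k ≤ Y := fun k hk => by
    rw [hYx]; exact pow_le_pow_right₀ hx1 hk
  have hYx1 : x ≤ Y := by simpa using hYge 1 (by norm_num)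
  have hY17 : 17 ≤ Y := hx17.trans hYx1
  have hY1 : 1 ≤ Y := by linarith
  have hY0 : 0 < Y := by linarith
  have hYpow : ∀ {j k : ℕ}, j ≤ k → Y ^ j ≤ Y ^ k := fun h => pow_le_pow_right₀ hY1 h
  set H := ⌊Y ^ 51⌋₊ with hH
  have hHle : (H : ℝ) ≤ Y ^ 51 := Nat.floor_le (by positivity)
  have hHge : Y ^ 51 / 2 ≤ H := by
    have h1 : Y ^ 51 < H + 1 := Nat.lt_floor_add_one _
    have h2 : Y ^ 1 ≤ Y ^ 51 := hYpow (by norm_num)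
    linarith
  have hH0 : (0 : ℝ) < H := lt_of_lt_of_le (by positivity) hHge
  set V := ⌈Y⌉₊ with hV
  have hVge : Y ≤ V := Nat.le_ceil _
  have hVle : (V : ℝ) ≤ 2 * Y := by
    have := Nat.ceil_lt_add_one hY0.le
    linarith
  have hV0 : (0 : ℝ) < V := lt_of_lt_of_le hY0 hVge
  set U := ⌊(H : ℝ) / (V * x)⌋₊ with hU
  have hUle : (U : ℝ) ≤ H / (V * x) := Nat.floor_le (by positivity)
  have hUV : (U : ℝ) * V ≤ H / x := by
    calc (U : ℝ) * V ≤ H / (V * x) * V := by gcongr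
      _ = H / x := by field_simp
  have hHx : 4 * Y * x ≤ Y ^ 51 := by
    calc 4 * Y * x ≤ Y * Y * Y := by gcongr; linarith
      _ = Y ^ 3 := by ring
      _ ≤ _ := hYpow (by norm_num)
  have hUge : (H : ℝ) / (2 * (V * x)) ≤ U := by
    have h1 : (H : ℝ) / (V * x) < U + 1 := Nat.lt_floor_add_one _
    have h2 : 1 ≤ (H : ℝ) / (V * x) := by
      rw [one_le_div (by positivity)]
      calc (V : ℝ) * x ≤ 2 * Y * x := by gcongr
        _ ≤ Y ^ 51 / 2 := by linarith
        _ ≤ H := hHge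
    have hU1 : (1 : ℝ) ≤ U := by
      have : 1 ≤ U := Nat.le_floor (by simpa using h2)
      exact_mod_cast this
    have : (H : ℝ) / (2 * (V * x)) = (H / (V * x)) / 2 := by field_simp
    rw [this]; linarith
  have hU0 : (0 : ℝ) < U := lt_of_lt_of_le (by positivity) hUge
  have hUH : (U : ℝ) ≤ H := by
    refine hUle.trans (div_le_self hH0.le ?_)
    nlinarith
  have hpr : ∀ n : ℕ, (n : ℝ) < Y ^ 200 → n < p := fun n hn => by
    rw [← hpY] at hn; exact_mod_cast hn
  have hYlt : ∀ {j k : ℕ}, j < k → Y ^ j < Y ^ k := fun h =>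
    pow_lt_pow_right₀ (by linarith) h
  have hHU : H * U < p := by
    apply hpr
    push_cast
    calc (H : ℝ) * U ≤ Y ^ 51 * Y ^ 51 := by
          gcongr; exact hUH.trans hHle
      _ = Y ^ 102 := by rw [← pow_add]
      _ < Y ^ 200 := hYlt (by norm_num)
  have hUp : U < p := hpr _ ((hUH.trans hHle).trans_lt (hYlt (by norm_num)))
  have hVp : V ≤ p := by
    apply (hpr _ _).le
    calc (V : ℝ) ≤ Y * Y := by nlinarith
      _ = Y ^ 2 := by ring
      _ < _ := hYlt (by norm_num)
  have ht : 3 * orderOf χ < Nat.sqrt (p - 1) := by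
    rw [Nat.lt_iff_add_one_le, Nat.le_sqrt]
    apply Nat.le_sub_one_of_lt
    apply hpr
    push_cast
    calc (3 * (orderOf χ : ℝ) + 1) * (3 * orderOf χ + 1) ≤ (3 * x + 1) * (3 * x + 1) := by gcongr
      _ ≤ x ^ 3 := by nlinarith [mul_nonneg hx0.le hx0.le]
      _ ≤ Y ^ 1 := by rw [pow_one]; exact hYge 3 (by norm_num)
      _ < _ := hYlt (by norm_num)
  obtain ⟨B, hB0, hB1, hB2⟩ := burgess_inequality χ hd ht (H := H) (U := U) (V := V) (r := 99)
    (D := ⌊x⌋₊) hHU hUp hVp (fun n h1 h2 => Nat.le_floor (hdiv n h1 h2))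
  have hDx : (⌊x⌋₊ : ℝ) ≤ x := Nat.floor_le hx0.le
  have htY : (Nat.sqrt (p - 1) : ℝ) ≤ Y ^ 100 := by
    have h1 : (Nat.sqrt (p - 1)) ^ 2 ≤ p := (Nat.sqrt_le' _).trans (Nat.sub_le _ _)
    have h2 : ((Nat.sqrt (p - 1) : ℝ)) ^ 2 ≤ (Y ^ 100) ^ 2 := by
      rw [← pow_mul, ← hpY]; exact_mod_cast h1
    exact le_of_sq_le_sq h2 (by positivity)
  have hmom : ((99 + 1 : ℕ) : ℝ) ^ (2 * (99 + 1)) * V ^ (99 + 1) * p +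
      V ^ (2 * (99 + 1)) * (18 * (99 + 1 : ℕ) * (orderOf χ : ℝ) ^ 3 * Nat.sqrt (p - 1)) ≤
      V ^ 200 * Y ^ 100 * (C * x ^ 3) := by
    generalize hc1 : ((99 + 1 : ℕ) : ℝ) ^ (2 * (99 + 1)) = c₁ at hC ⊢
    generalize hc2 : ((99 + 1 : ℕ) : ℝ) = c₂ at hC ⊢
    have hc1' : 0 ≤ c₁ := by rw [← hc1]; positivity
    have hc2' : 0 ≤ c₂ := by rw [← hc2]; positivity
    have hx3 : 1 ≤ x ^ 3 := one_le_pow₀ hx1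
    have h1 : c₁ * V ^ (99 + 1) * p ≤ V ^ 200 * Y ^ 100 * (c₁ * x ^ 3) := by
      calc c₁ * V ^ (99 + 1) * p = c₁ * V ^ 100 * (Y ^ 100 * Y ^ 100) := by
            rw [hpY, ← pow_add]
        _ ≤ c₁ * V ^ 100 * (V ^ 100 * Y ^ 100) := by gcongr
        _ = V ^ 200 * Y ^ 100 * (c₁ * 1) := by ring
        _ ≤ _ := by gcongr
    have h2 : (V : ℝ) ^ (2 * (99 + 1)) * (18 * c₂ * (orderOf χ : ℝ) ^ 3 * Nat.sqrt (p - 1)) ≤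
        V ^ 200 * Y ^ 100 * (18 * c₂ * x ^ 3) := by
      calc _ ≤ (V : ℝ) ^ 200 * (18 * c₂ * x ^ 3 * Y ^ 100) := by
            rw [show 2 * (99 + 1) = 200 from rfl]
            gcongr
        _ = _ := by ring
    rw [hC]
    linarith
  have hHUge : Y ^ 101 ≤ 16 * x * (H * U) := by
    have h1 : (H : ℝ) / (2 * (V * x)) * H ≤ U * H := by gcongr
    have h2 : Y ^ 101 / (16 * x) ≤ (H : ℝ) / (2 * (V * x)) * H := by
      calc Y ^ 101 / (16 * x) = (Y ^ 51 / 2) / (2 * (2 * Y * x)) * (Y ^ 51 / 2) := by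
            field_simp; ring
        _ ≤ _ := by gcongr
    rw [div_le_iff₀ (by positivity)] at h2
    nlinarith
  have hfin : B ≤ H * U * V / x := by
    have hpow : B ^ 200 ≤ (H * U * V / x) ^ 200 := by
      calc B ^ 200 ≤ ((H : ℝ) * U) ^ 199 * x * (V ^ 200 * Y ^ 100 * (C * x ^ 3)) := by
            refine hB2.trans ?_
            rw [show 2 * 99 + 1 = 199 from rfl]
            refine (mul_le_mul_of_nonneg_left hmom
              (mul_nonneg (pow_nonneg (mul_nonneg hH0.le (Nat.cast_nonneg U)) 199)
                (Nat.cast_nonneg _))).trans ?_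
            exact mul_le_mul_of_nonneg_right (mul_le_mul_of_nonneg_left hDx (by positivity))
              (by positivity)
        _ ≤ (H * U * V / x) ^ 200 := by
            have h1 : Y ^ 100 * (x * (C * x ^ 3)) * x ^ 200 ≤ H * U := by
              have h2 : 16 * x * (Y ^ 100 * (x * (C * x ^ 3)) * x ^ 200) ≤ 16 * x * (H * U) := by
                refine le_trans ?_ hHUge
                calc 16 * x * (Y ^ 100 * (x * (C * x ^ 3)) * x ^ 200)
                    = Y ^ 100 * ((16 * C) * x ^ 205) := by ring
                  _ ≤ Y ^ 100 * (x * x ^ 205) := by gcongr; linarith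
                  _ = Y ^ 100 * x ^ 206 := by ring
                  _ ≤ Y ^ 100 * Y := by gcongr; exact hYge 206 (by norm_num)
                  _ = Y ^ 101 := by ring
              exact le_of_mul_le_mul_left h2 (by positivity)
            rw [div_pow, le_div_iff₀ (by positivity)]
            calc ((H : ℝ) * U) ^ 199 * x * (V ^ 200 * Y ^ 100 * (C * x ^ 3)) * x ^ 200
                = ((H : ℝ) * U) ^ 199 * V ^ 200 * (Y ^ 100 * (x * (C * x ^ 3)) * x ^ 200) := by
                  ring
              _ ≤ ((H : ℝ) * U) ^ 199 * V ^ 200 * (H * U) := by gcongr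
              _ = _ := by ring
    exact le_of_pow_le_pow_left₀ (by norm_num) (by positivity) hpow
  have hlast : U * V * ‖∑ n ∈ Finset.Icc 1 H, χ (n : ZMod p)‖ ≤ U * V * (3 * H / x) := by
    refine hB1.trans ?_
    calc 2 * ((U : ℝ) * V) ^ 2 + B ≤ 2 * (U * V * (H / x)) + H * U * V / x := by
          rw [sq]; gcongr
      _ = _ := by field_simp; ring
  exact le_of_mul_le_mul_left hlast (by positivity)

theorem MulChar.apply_eq_of_pow_eq {p : ℕ} [Fact p.Prime] {χ : MulChar (ZMod p) ℂ} {e : ℕ}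
    (he : orderOf χ * e = p - 1) {x y : ZMod p} (hx : x ≠ 0) (hy : y ≠ 0) (h : x ^ e = y ^ e) :
    χ x = χ y := by
  obtain ⟨g, hg, -⟩ := MulChar.exists_generator_zmod (χ := χ)
  have hp1 : 0 < p - 1 := Nat.sub_pos_of_lt (Fact.out : p.Prime).one_lt
  have he0 : 0 < e := Nat.pos_of_ne_zero (by rintro rfl; omega)
  lift x to (ZMod p)ˣ using hx.isUnit
  lift y to (ZMod p)ˣ using hy.isUnit
  obtain ⟨k, hk⟩ := mem_powers_iff_mem_zpowers.mpr (hg (x * y⁻¹))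
  have hk' : g ^ k = x * y⁻¹ := hk
  have hxy : x ^ e = y ^ e := by ext; push_cast; exact h
  have hord : orderOf g = p - 1 := by
    rw [orderOf_eq_card_of_forall_mem_zpowers hg, Nat.card_eq_fintype_card, ZMod.card_units]
  have hdvd : p - 1 ∣ k * e := by
    rw [← hord]
    apply orderOf_dvd_of_pow_eq_one
    rw [pow_mul, hk', mul_pow, inv_pow, hxy, mul_inv_cancel]
  rw [← he] at hdvd
  obtain ⟨j, hj⟩ := Nat.dvd_of_mul_dvd_mul_right he0 hdvd
  have hx' : x = (g ^ j) ^ orderOf χ * y := by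
    rw [← pow_mul, mul_comm j, ← hj, hk', inv_mul_cancel_right]
  rw [hx', Units.val_mul, map_mul, Units.val_pow_eq_pow_val, map_pow,
    χ.apply_pow_orderOf (Units.ne_zero _), one_mul]

theorem abs_card_filter_pow_eq_sub_le {p : ℕ} [Fact p.Prime] {d e H : ℕ} {E : ℝ} (hE : 0 ≤ E)
    (he : d * e = p - 1) {c : ZMod p} (hc : c ≠ 0) (hH : H < p)
    (hsum : ∀ χ : MulChar (ZMod p) ℂ, 2 ≤ orderOf χ → orderOf χ ≤ d →
      ‖∑ n ∈ Finset.Icc 1 H, χ (n : ZMod p)‖ ≤ E) :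
    |(((Finset.Icc 1 H).filter fun a : ℕ => (a : ZMod p) ^ e = c ^ e).card : ℝ) - H / d| ≤ E := by
  have hp1 : 0 < p - 1 := Nat.sub_pos_of_lt (Fact.out : p.Prime).one_lt
  have hd0 : 0 < d := Nat.pos_of_ne_zero (by rintro rfl; omega)
  obtain ⟨χ, hχ⟩ := MulChar.exists_mulChar_orderOf (ZMod p) (n := d)
    (by rw [ZMod.card]; exact ⟨e, he.symm⟩) (Complex.isPrimitiveRoot_exp d hd0.ne')
  have hne : ∀ a ∈ Finset.Icc 1 H, (a : ZMod p) ≠ 0 := by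
    intro a ha h
    rw [Finset.mem_Icc] at ha
    exact absurd (Nat.le_of_dvd (by omega) ((ZMod.natCast_eq_zero_iff a p).mp h)) (by omega)
  have hχc : χ c ≠ 0 := by
    rw [← norm_ne_zero_iff, χ.norm_apply_eq_one hc]; exact one_ne_zero
  have hgeom : ∀ a ∈ Finset.Icc 1 H, ∑ j ∈ Finset.range d, (χ (a : ZMod p) * (χ c)⁻¹) ^ j =
      if (a : ZMod p) ^ e = c ^ e then (d : ℂ) else 0 := by
    intro a ha
    split_ifs with h
    · rw [MulChar.apply_eq_of_pow_eq (by rw [hχ, he]) (hne a ha) hc h, mul_inv_cancel₀ hχc]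
      simp
    · have h1 : χ (a : ZMod p) * (χ c)⁻¹ ≠ 1 := by
        intro h1
        exact h (MulChar.pow_eq_of_apply_eq (by rw [hχ, he]) (hne a ha) hc
          ((mul_inv_eq_one₀ hχc).mp h1))
      rw [geom_sum_eq h1, mul_pow, inv_pow, ← hχ, χ.apply_pow_orderOf (hne a ha),
        χ.apply_pow_orderOf hc]
      simp
  set N := ((Finset.Icc 1 H).filter fun a : ℕ => (a : ZMod p) ^ e = c ^ e).card with hN
  have htotal : (d : ℂ) * N = ∑ j ∈ Finset.range d, (χ c)⁻¹ ^ j *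
      ∑ a ∈ Finset.Icc 1 H, (χ ^ j) (a : ZMod p) := by
    have h1 : (d : ℂ) * N = ∑ a ∈ Finset.Icc 1 H,
        ∑ j ∈ Finset.range d, (χ (a : ZMod p) * (χ c)⁻¹) ^ j := by
      rw [Finset.sum_congr rfl hgeom, ← Finset.sum_filter, Finset.sum_const, ← hN, nsmul_eq_mul,
        mul_comm]
    rw [h1, Finset.sum_comm]
    refine Finset.sum_congr rfl fun j _ => ?_
    rw [Finset.mul_sum]
    refine Finset.sum_congr rfl fun a ha => ?_
    have : ((χ ^ j) (a : ZMod p)) = χ (a : ZMod p) ^ j := by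
      rw [← (hne a ha).isUnit.unit_spec, MulChar.pow_apply_coe]
    rw [this, mul_pow, mul_comm]
  obtain ⟨d', rfl⟩ : ∃ d', d = d' + 1 := ⟨d - 1, by omega⟩
  have hzero : ∑ a ∈ Finset.Icc 1 H, (χ ^ 0) (a : ZMod p) = (H : ℂ) := by
    have : ∀ a ∈ Finset.Icc 1 H, (χ ^ 0) (a : ZMod p) = 1 := fun a ha => by
      rw [pow_zero, MulChar.one_apply (hne a ha).isUnit]
    rw [Finset.sum_congr rfl this]
    simp
  rw [Finset.sum_range_succ', hzero] at htotal
  simp only [pow_zero, one_mul] at htotal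
  have hbound : ‖((d' + 1 : ℕ) : ℂ) * N - H‖ ≤ d' * E := by
    rw [htotal, add_sub_cancel_right]
    refine (norm_sum_le _ _).trans ?_
    refine (Finset.sum_le_card_nsmul _ _ E fun j hj => ?_).trans_eq (by simp)
    rw [Finset.mem_range] at hj
    have hnorm : ‖(χ c)⁻¹ ^ (j + 1)‖ = 1 := by
      rw [norm_pow, norm_inv, χ.norm_apply_eq_one hc]; simp
    rw [norm_mul, hnorm, one_mul]
    have hne1 : χ ^ (j + 1) ≠ 1 := by
      intro h
      exact absurd (Nat.le_of_dvd (by omega) (orderOf_dvd_of_pow_eq_one h)) (by omega)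
    have hle : orderOf (χ ^ (j + 1)) ≤ orderOf χ :=
      Nat.le_of_dvd χ.orderOf_pos (orderOf_pow_dvd _)
    refine hsum _ ?_ (by omega)
    have h1 := (χ ^ (j + 1)).orderOf_pos
    have h2 : orderOf (χ ^ (j + 1)) ≠ 1 := fun h => hne1 (orderOf_eq_one_iff.mp h)
    omega
  have hreal : |((d' + 1 : ℕ) : ℝ) * N - H| ≤ d' * E := by
    rw [← Real.norm_eq_abs, ← Complex.norm_real]
    push_cast at hbound ⊢
    exact hbound
  have hd1 : (0 : ℝ) < ((d' + 1 : ℕ) : ℝ) := by positivity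
  have heq : (N : ℝ) - H / ((d' + 1 : ℕ) : ℝ) =
      (((d' + 1 : ℕ) : ℝ) * N - H) / ((d' + 1 : ℕ) : ℝ) := by
    field_simp
  rw [heq, abs_div, abs_of_pos hd1, div_le_iff₀ hd1]
  push_cast at hreal ⊢
  nlinarith

open Polynomial in
theorem card_filter_natCast_pow_eq_le {p : ℕ} [Fact p.Prime] {e : ℕ} (he : 0 < e) (M : ℕ)
    (κ : ZMod p) :
    ((Finset.Icc 1 M).filter fun n : ℕ => (n : ZMod p) ^ e = κ).card ≤ e * (M / p + 1) := by
  classical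
  have hroots : (nthRoots e κ).toFinset.card ≤ e :=
    (Multiset.toFinset_card_le _).trans (card_nthRoots e κ)
  calc _ ≤ ((nthRoots e κ).toFinset ×ˢ Finset.range (M / p + 1)).card := by
        apply Finset.card_le_card_of_injOn fun n : ℕ => ((n : ZMod p), n / p)
        · intro n hn
          simp only [Finset.coe_filter, Set.mem_ofPred_eq, Finset.mem_Icc] at hn
          simp only [Finset.coe_product, Set.mem_prod, Finset.mem_coe, Multiset.mem_toFinset,
            mem_nthRoots he, Finset.mem_range]
          exact ⟨hn.2, Nat.lt_succ_of_le (Nat.div_le_div_right hn.1.2)⟩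
        · intro m _ n _ h
          simp only [Prod.mk.injEq] at h
          have h1 := (ZMod.natCast_eq_natCast_iff' m n p).mp h.1
          rw [← Nat.div_add_mod m p, ← Nat.div_add_mod n p, h1, h.2]
    _ ≤ e * (M / p + 1) := by
        rw [Finset.card_product, Finset.card_range]
        exact Nat.mul_le_mul_right _ hroots

theorem card_filter_pow_eq_pow_four_le {p : ℕ} [Fact p.Prime] {e H D : ℕ} (he : 0 < e)
    (hH : H ^ 4 < p ^ 2) (hD : ∀ n, 1 ≤ n → n < p ^ 2 → n.divisors.card ≤ D) (κ : ZMod p) :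
    ((Finset.Icc 1 H).filter fun n : ℕ => (n : ZMod p) ^ e = κ).card ^ 4 ≤
      D ^ 4 * (e * (H ^ 4 / p + 1)) := by
  classical
  set A := (Finset.Icc 1 H).filter fun n : ℕ => (n : ZMod p) ^ e = κ with hA
  set T := (Finset.Icc 1 (H ^ 4)).filter fun n : ℕ => (n : ZMod p) ^ e = κ ^ 4 with hT
  have hAmem : ∀ a ∈ A, 1 ≤ a ∧ a ≤ H ∧ (a : ZMod p) ^ e = κ := fun a ha => by
    rw [hA, Finset.mem_filter, Finset.mem_Icc] at ha
    exact ⟨ha.1.1, ha.1.2, ha.2⟩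
  have hmaps : ∀ q ∈ A ×ˢ A ×ˢ A ×ˢ A, q.1 * q.2.1 * q.2.2.1 * q.2.2.2 ∈ T := by
    rintro ⟨a, b, c, d⟩ hq
    simp only [Finset.mem_product] at hq
    obtain ⟨ha1, ha2, ha3⟩ := hAmem a hq.1
    obtain ⟨hb1, hb2, hb3⟩ := hAmem b hq.2.1
    obtain ⟨hc1, hc2, hc3⟩ := hAmem c hq.2.2.1
    obtain ⟨hd1, hd2, hd3⟩ := hAmem d hq.2.2.2
    rw [hT, Finset.mem_filter, Finset.mem_Icc]
    refine ⟨⟨Nat.succ_le_of_lt (by positivity), ?_⟩, ?_⟩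
    · calc a * b * c * d ≤ H * H * H * H := by gcongr
        _ = H ^ 4 := by ring
    · push_cast
      rw [mul_pow, mul_pow, mul_pow, ha3, hb3, hc3, hd3]
      ring
  have hfib : ∀ n ∈ T, ((A ×ˢ A ×ˢ A ×ˢ A).filter
      fun q => q.1 * q.2.1 * q.2.2.1 * q.2.2.2 = n).card ≤ D ^ 4 := by
    intro n hn
    rw [hT, Finset.mem_filter, Finset.mem_Icc] at hn
    have hn0 : n ≠ 0 := by omega
    calc _ ≤ (n.divisors ×ˢ n.divisors ×ˢ n.divisors ×ˢ n.divisors).card := by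
          apply Finset.card_le_card
          rintro ⟨a, b, c, d⟩ hq
          simp only [Finset.mem_filter] at hq
          simp only [Finset.mem_product, Nat.mem_divisors]
          refine ⟨⟨⟨b * c * d, ?_⟩, hn0⟩, ⟨⟨a * c * d, ?_⟩, hn0⟩, ⟨⟨a * b * d, ?_⟩, hn0⟩,
            ⟨⟨a * b * c, ?_⟩, hn0⟩⟩ <;> rw [← hq.2] <;> ring
      _ = n.divisors.card ^ 4 := by simp only [Finset.card_product]; ring
      _ ≤ D ^ 4 := Nat.pow_le_pow_left (hD n hn.1.1 (hn.1.2.trans_lt hH)) 4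
  calc A.card ^ 4 = (A ×ˢ A ×ˢ A ×ˢ A).card := by simp only [Finset.card_product]; ring
    _ ≤ D ^ 4 * T.card := Finset.card_le_mul_card_image_of_maps_to hmaps _ hfib
    _ ≤ _ := Nat.mul_le_mul_left _ (card_filter_natCast_pow_eq_le he _ _)

theorem card_primes_log_eq_mul_le (N : ℕ) {i : ℕ} (hi : 2 ≤ i) :
    ((Finset.range N).filter fun ℓ => ℓ.Prime ∧ Nat.log 2 ℓ = i).card * i ≤ 2 * 2 ^ i := by
  set P := (Finset.range N).filter fun ℓ => ℓ.Prime ∧ Nat.log 2 ℓ = i with hP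
  have hmem : ∀ ℓ ∈ P, ℓ.Prime ∧ 2 ^ i ≤ ℓ ∧ ℓ < 2 ^ (i + 1) := by
    intro ℓ hℓ
    rw [hP, Finset.mem_filter] at hℓ
    obtain ⟨-, hpr, rfl⟩ := hℓ
    exact ⟨hpr, Nat.pow_log_le_self 2 hpr.ne_zero, Nat.lt_pow_succ_log_self (by norm_num) ℓ⟩
  have hdvd : ∏ ℓ ∈ P, ℓ ∣ (2 ^ i).centralBinom := by
    refine Finset.prod_primes_dvd _ (fun ℓ hℓ => (hmem ℓ hℓ).1.prime) fun ℓ hℓ => ?_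
    obtain ⟨hpr, h1, h2⟩ := hmem ℓ hℓ
    have hne : ℓ ≠ 2 ^ i := by
      rintro rfl
      exact Nat.Prime.not_prime_pow hi hpr
    have h3 : 2 ^ (i + 1) = 2 * 2 ^ i := by ring
    exact hpr.dvd_choose (by omega) (by omega) (by omega)
  have hle : 2 ^ (i * P.card) ≤ 2 ^ (2 * 2 ^ i) := by
    calc 2 ^ (i * P.card) = ∏ ℓ ∈ P, 2 ^ i := by rw [Finset.prod_const, pow_mul]
      _ ≤ ∏ ℓ ∈ P, ℓ := Finset.prod_le_prod' fun ℓ hℓ => (hmem ℓ hℓ).2.1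
      _ ≤ (2 ^ i).centralBinom := Nat.le_of_dvd (Nat.centralBinom_pos _) hdvd
      _ ≤ 2 ^ (2 * 2 ^ i) := by
        rw [Nat.centralBinom]; exact Nat.choose_le_two_pow _ _
  rw [mul_comm]
  exact (Nat.pow_le_pow_iff_right (by norm_num)).mp hle

theorem sum_inv_primes_le (N I₀ I₁ : ℕ) (hI : 2 ≤ I₀) :
    ∑ ℓ ∈ (Finset.range N).filter fun ℓ => ℓ.Prime ∧ I₀ ≤ Nat.log 2 ℓ ∧ Nat.log 2 ℓ ≤ I₁,
      (1 : ℝ) / ℓ ≤ ∑ i ∈ Finset.Icc I₀ I₁, (2 : ℝ) / i := by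
  classical
  rw [← Finset.sum_fiberwise_of_maps_to (g := Nat.log 2) (t := Finset.Icc I₀ I₁)
    (fun ℓ hℓ => by
      rw [Finset.mem_filter] at hℓ
      exact Finset.mem_Icc.mpr hℓ.2.2)]
  refine Finset.sum_le_sum fun i hi => ?_
  rw [Finset.mem_Icc] at hi
  have hi2 : 2 ≤ i := hI.trans hi.1
  have hi0 : (0 : ℝ) < i := by positivity
  set P := (Finset.range N).filter fun ℓ => ℓ.Prime ∧ Nat.log 2 ℓ = i with hP
  have hcard : (P.card : ℝ) * i ≤ 2 * 2 ^ i := by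
    exact_mod_cast card_primes_log_eq_mul_le N hi2
  calc _ ≤ ∑ ℓ ∈ P, (1 : ℝ) / ℓ := by
        refine Finset.sum_le_sum_of_subset_of_nonneg ?_ fun _ _ _ => by positivity
        intro ℓ hℓ
        simp only [Finset.mem_filter] at hℓ
        exact Finset.mem_filter.mpr ⟨hℓ.1.1, hℓ.1.2.1, hℓ.2⟩
    _ ≤ ∑ ℓ ∈ P, (1 : ℝ) / 2 ^ i := by
        refine Finset.sum_le_sum fun ℓ hℓ => ?_
        rw [hP, Finset.mem_filter] at hℓ
        have h1 : ((2 : ℝ) ^ i) ≤ ℓ := by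
          have := Nat.pow_log_le_self 2 hℓ.2.1.ne_zero
          rw [hℓ.2.2] at this
          exact_mod_cast this
        gcongr
    _ ≤ 2 / i := by
        rw [Finset.sum_const, nsmul_eq_mul, mul_one_div, div_le_div_iff₀ (by positivity) hi0]
        exact hcard

theorem sum_Icc_one_div_le_log {a b : ℕ} (ha : 1 ≤ a) (hab : a ≤ b) :
    ∑ i ∈ Finset.Icc a b, (1 : ℝ) / i ≤ 1 / a + Real.log (b / a) := by
  induction b, hab using Nat.le_induction with
  | base =>
    have : (a : ℝ) ≠ 0 := by positivity
    simp [div_self this]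
  | succ n hn ih =>
    rw [Finset.sum_Icc_succ_top (by omega)]
    have ha0 : (0 : ℝ) < a := by positivity
    have hn0 : (0 : ℝ) < n := by have : 0 < n := by omega
                                 positivity
    have h1 := Real.one_sub_inv_le_log_of_pos (x := ((n + 1 : ℕ) : ℝ) / n) (by positivity)
    have h2 : Real.log (((n + 1 : ℕ) : ℝ) / a) =
        Real.log (n / a) + Real.log (((n + 1 : ℕ) : ℝ) / n) := by
      rw [← Real.log_mul (by positivity) (by positivity)]
      congr 1
      field_simp
    have h3 : 1 - (((n + 1 : ℕ) : ℝ) / n)⁻¹ = 1 / ((n + 1 : ℕ) : ℝ) := by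
      push_cast
      field_simp
      ring
    rw [h2]
    rw [h3] at h1
    linarith

theorem sum_Icc_two_div_le {I : ℕ} (hI : 600 ≤ I) :
    ∑ i ∈ Finset.Icc (407 * I / 510) I, (2 : ℝ) / i ≤ 49 / 100 := by
  set J := 407 * I / 510 with hJ
  have hJ400 : 400 ≤ J := by omega
  have hJI : J ≤ I := by omega
  have hIJ : 407 * I ≤ 510 * (J + 1) := by omega
  have h1 := sum_Icc_one_div_le_log (by omega : 1 ≤ J) hJI
  have hJR : (400 : ℝ) ≤ J := by exact_mod_cast hJ400
  have hIR : (407 : ℝ) * I ≤ 510 * (J + 1) := by exact_mod_cast hIJ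
  have hI0 : (0 : ℝ) < I := by have : 0 < I := by omega
                               positivity
  have h2 : (1 : ℝ) / J ≤ 1 / 400 := by gcongr
  have h3 : Real.log ((I : ℝ) / J) ≤ 0.2425 := by
    rw [Real.log_le_iff_le_exp (by positivity)]
    refine le_trans ?_ (Real.quadratic_le_exp_of_nonneg (by norm_num))
    rw [div_le_iff₀ (by linarith)]
    nlinarith
  have h4 : ∑ i ∈ Finset.Icc J I, (2 : ℝ) / i = 2 * ∑ i ∈ Finset.Icc J I, (1 : ℝ) / i := by
    rw [Finset.mul_sum]
    exact Finset.sum_congr rfl fun i _ => by ring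
  rw [h4]
  norm_num at h3 h2 ⊢
  norm_num at h1
  linarith

theorem MulChar.sub_le_norm_sum {p : ℕ} [Fact p.Prime] (χ : MulChar (ZMod p) ℂ) (H : ℕ)
    (W : Finset ℕ) (hW : ∀ ℓ, ℓ.Prime → ℓ ≤ H → χ (ℓ : ZMod p) ≠ 1 → ℓ ∈ W) :
    (H : ℝ) - 2 * ∑ ℓ ∈ W, H * (1 / (ℓ : ℝ)) ≤ ‖∑ n ∈ Finset.Icc 1 H, χ (n : ZMod p)‖ := by
  classical
  have hone : ∀ n, 1 ≤ n → n ≤ H → (∀ ℓ ∈ W, ¬ ℓ ∣ n) → χ (n : ZMod p) = 1 := by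
    intro n
    induction n using Nat.recOnMul with
    | zero => intro h; omega
    | one => intros; simp
    | prime q hq =>
      intro _ hqH hn
      by_contra hne
      exact hn q (hW q hq hqH hne) dvd_rfl
    | mul a b iha ihb =>
      intro h1 hH hn
      have ha0 : 0 < a := Nat.pos_of_ne_zero (by rintro rfl; omega)
      have hb0 : 0 < b := Nat.pos_of_ne_zero (by rintro rfl; omega)
      rw [Nat.cast_mul, map_mul, iha ha0 ((Nat.le_mul_of_pos_right a hb0).trans hH)
        fun ℓ hℓ h => hn ℓ hℓ (h.mul_right b), ihb hb0 ((Nat.le_mul_of_pos_left b ha0).trans hH)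
        fun ℓ hℓ h => hn ℓ hℓ (h.mul_left a), one_mul]
  set B := (Finset.Icc 1 H).filter fun n => ∃ ℓ ∈ W, ℓ ∣ n with hB
  have hBcard : (B.card : ℝ) ≤ ∑ ℓ ∈ W, H * (1 / (ℓ : ℝ)) := by
    have hsub : B ⊆ W.biUnion fun ℓ => (Finset.Icc 1 H).filter fun n => ℓ ∣ n := by
      intro n hn
      rw [hB, Finset.mem_filter] at hn
      obtain ⟨hn, ℓ, hℓ, hd⟩ := hn
      exact Finset.mem_biUnion.mpr ⟨ℓ, hℓ, Finset.mem_filter.mpr ⟨hn, hd⟩⟩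
    have h1 : B.card ≤ ∑ ℓ ∈ W, H / ℓ := by
      refine (Finset.card_le_card hsub).trans (Finset.card_biUnion_le.trans_eq ?_)
      refine Finset.sum_congr rfl fun ℓ _ => ?_
      rw [← Nat.Ioc_filter_dvd_card_eq_div H ℓ]
      rfl
    calc (B.card : ℝ) ≤ ((∑ ℓ ∈ W, H / ℓ : ℕ) : ℝ) := by exact_mod_cast h1
      _ ≤ _ := by
        push_cast
        refine Finset.sum_le_sum fun ℓ _ => ?_
        rw [mul_one_div]
        exact Nat.cast_div_le
  have hre : ∀ n ∈ Finset.Icc 1 H, 1 - (if n ∈ B then (2 : ℝ) else 0) ≤ (χ (n : ZMod p)).re := by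
    intro n hn
    split_ifs with h
    · have h1 := (Complex.abs_re_le_norm _).trans (χ.norm_apply_le_one (n : ZMod p))
      have h2 := (abs_le.mp h1).1
      linarith
    · have hn' := Finset.mem_Icc.mp hn
      rw [hone n hn'.1 hn'.2 fun ℓ hℓ hd => h (Finset.mem_filter.mpr ⟨hn, ℓ, hℓ, hd⟩)]
      simp
  have hBsub : (Finset.Icc 1 H).filter (· ∈ B) = B := by
    rw [Finset.filter_mem_eq_inter, Finset.inter_eq_right]
    exact Finset.filter_subset _ _
  calc (H : ℝ) - 2 * ∑ ℓ ∈ W, H * (1 / (ℓ : ℝ)) ≤ H - 2 * B.card := by linarith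
    _ = ∑ n ∈ Finset.Icc 1 H, (1 - (if n ∈ B then (2 : ℝ) else 0)) := by
        rw [Finset.sum_sub_distrib, ← Finset.sum_filter, hBsub]
        simp [mul_comm]
    _ ≤ ∑ n ∈ Finset.Icc 1 H, (χ (n : ZMod p)).re := Finset.sum_le_sum hre
    _ = (∑ n ∈ Finset.Icc 1 H, χ (n : ZMod p)).re := by rw [Complex.re_sum]
    _ ≤ _ := Complex.re_le_norm _

theorem MulChar.exists_prime_apply_ne_one {p : ℕ} [Fact p.Prime] (χ : MulChar (ZMod p) ℂ) {H : ℕ}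
    (hH : 600 ≤ Nat.log 2 H) (hsum : ‖∑ n ∈ Finset.Icc 1 H, χ (n : ZMod p)‖ < H / 50) :
    ∃ ℓ : ℕ, ℓ.Prime ∧ ℓ ≤ H ∧ ℓ ^ 510 ≤ H ^ 407 ∧ χ (ℓ : ZMod p) ≠ 1 := by
  by_contra! hcon
  have hH0 : H ≠ 0 := by
    rintro rfl
    simp at hH
  set I := Nat.log 2 H with hI
  have hsmall := sum_Icc_two_div_le hH
  set J := 407 * I / 510 with hJ
  have h1 := χ.sub_le_norm_sum H ((Finset.range (H + 1)).filter fun ℓ =>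
    ℓ.Prime ∧ J ≤ Nat.log 2 ℓ ∧ Nat.log 2 ℓ ≤ I) (by
      intro ℓ hℓ hℓH hne
      rw [Finset.mem_filter, Finset.mem_range]
      refine ⟨Nat.lt_succ_of_le hℓH, hℓ, ?_, Nat.log_mono_right hℓH⟩
      by_contra! hlt
      refine hne (hcon ℓ hℓ hℓH ?_)
      calc ℓ ^ 510 ≤ (2 ^ J) ^ 510 := by
            refine Nat.pow_le_pow_left ?_ _
            exact (Nat.lt_pow_succ_log_self (by norm_num) ℓ).le.trans
              (Nat.pow_le_pow_right (by norm_num) hlt)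
        _ = 2 ^ (J * 510) := by rw [pow_mul]
        _ ≤ 2 ^ (I * 407) := Nat.pow_le_pow_right (by norm_num) (by omega)
        _ = (2 ^ I) ^ 407 := by rw [pow_mul]
        _ ≤ H ^ 407 := Nat.pow_le_pow_left (Nat.pow_log_le_self 2 hH0) _)
  have h2 := sum_inv_primes_le (H + 1) J I (by omega)
  rw [← Finset.mul_sum] at h1
  have hHR : (0 : ℝ) < H := by positivity
  have h3 := mul_le_mul_of_nonneg_left (h2.trans hsmall) hHR.le
  linarith

theorem pow_div_eq_one_of_coprime {G : Type*} [CommMonoid G] {z : G} {n k ℓ : ℕ} (hk : k ∣ n)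
    (hℓ : ℓ ∣ n) (hkℓ : k.Coprime ℓ) (h1 : z ^ (n / k) = 1) (h2 : z ^ (n / ℓ) = 1) :
    z ^ (n / (k * ℓ)) = 1 := by
  obtain ⟨w, rfl⟩ := hkℓ.mul_dvd_of_dvd_of_dvd hk hℓ
  rcases Nat.eq_zero_or_pos k with rfl | hk0
  · simp
  rcases Nat.eq_zero_or_pos ℓ with rfl | hℓ0
  · simp
  rw [mul_assoc, Nat.mul_div_cancel_left _ hk0] at h1
  rw [mul_comm k ℓ, mul_assoc, Nat.mul_div_cancel_left _ hℓ0] at h2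
  rw [Nat.mul_div_cancel_left _ (Nat.mul_pos hk0 hℓ0)]
  have h3 := Nat.dvd_gcd (orderOf_dvd_of_pow_eq_one h1) (orderOf_dvd_of_pow_eq_one h2)
  rw [Nat.gcd_mul_right, Nat.Coprime.gcd_eq_one hkℓ.symm, one_mul] at h3
  exact orderOf_dvd_iff_pow_eq_one.mp h3

theorem ZMod.pow_div_eq_one_of_sq {p : ℕ} [Fact p.Prime] {z : ZMod p} (hz : z ≠ 0) {ℓ : ℕ}
    (hodd : Odd ℓ) (hℓ : ℓ ∣ p - 1) (h : (z ^ 2) ^ ((p - 1) / ℓ) = 1) :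
    z ^ ((p - 1) / ℓ) = 1 := by
  obtain ⟨w, hw⟩ := hℓ
  rw [hw, Nat.mul_div_cancel_left _ hodd.pos] at h ⊢
  rw [← pow_mul] at h
  have h1 := Nat.dvd_gcd (orderOf_dvd_of_pow_eq_one h)
    (orderOf_dvd_of_pow_eq_one (ZMod.pow_card_sub_one_eq_one hz))
  rw [hw, Nat.gcd_mul_right, Nat.Coprime.gcd_eq_one (Nat.coprime_two_left.mpr hodd), one_mul] at h1
  exact orderOf_dvd_iff_pow_eq_one.mp h1

theorem ZMod.exists_sq_mul_cube_eq {p : ℕ} [Fact p.Prime] {g q : ZMod p}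
    (hg : g ≠ 0) (hq : q ≠ 0) (hgsq : g ^ (p / 2) ≠ 1) (hqsq : q ^ (p / 2) ≠ 1) :
    ∃ c : ZMod p, c ≠ 0 ∧ c ^ 2 * q ^ 3 = g := by
  have hgq : (g * q) ^ (p / 2) = 1 := by
    rw [mul_pow, (ZMod.pow_div_two_eq_neg_one_or_one p hg).resolve_left hgsq,
      (ZMod.pow_div_two_eq_neg_one_or_one p hq).resolve_left hqsq]
    ring
  obtain ⟨r, hr⟩ := (ZMod.euler_criterion p (mul_ne_zero hg hq)).mpr hgq
  have hr0 : r ≠ 0 := by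
    rintro rfl
    exact mul_ne_zero hg hq (by rw [hr, zero_mul])
  refine ⟨r * (q ^ 2)⁻¹, mul_ne_zero hr0 (inv_ne_zero (pow_ne_zero 2 hq)), ?_⟩
  field_simp
  rw [sq, ← hr, mul_comm]

theorem exists_orderOf_sq_mul_cube_eq {p : ℕ} [Fact p.Prime] (hp2 : p ≠ 2) {H q k : ℕ}
    (hH : H < p) (hq0 : (q : ZMod p) ≠ 0) (hq : (q : ZMod p) ^ (p / 2) ≠ 1) (hk : k ∣ p - 1)
    {R : Finset ℕ} (hR : ∀ ℓ ∈ R, ℓ.Prime ∧ Odd ℓ ∧ ℓ ∣ p - 1 ∧ k.Coprime ℓ)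
    (hcover : ∀ ℓ, ℓ.Prime → ℓ ∣ p - 1 → ℓ = 2 ∨ ℓ ∣ k ∨ ℓ ∈ R) {N₀ : ℝ} {B : ℕ → ℝ}
    (hN₀ : ∀ c : ZMod p, c ≠ 0 → N₀ ≤ ((Finset.Icc 1 H).filter
      fun a : ℕ => (a : ZMod p) ^ ((p - 1) / k) = c ^ ((p - 1) / k)).card)
    (hB0 : ∀ ℓ ∈ R, 0 ≤ B ℓ)
    (hB : ∀ ℓ ∈ R, ∃ m, (m = k * ℓ ∨ m = ℓ) ∧ ∀ c : ZMod p, c ≠ 0 → (((Finset.Icc 1 H).filter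
      fun a : ℕ => (a : ZMod p) ^ ((p - 1) / m) = c ^ ((p - 1) / m)).card : ℝ) ≤ B ℓ)
    (hlt : ∑ ℓ ∈ R, B ℓ < N₀) :
    ∃ a ∈ Finset.Icc 1 H, orderOf ((a ^ 2 * q ^ 3 : ℕ) : ZMod p) = p - 1 := by
  classical
  have hpP : p.Prime := Fact.out
  have hp1 : 0 < p - 1 := Nat.sub_pos_of_lt hpP.one_lt
  have hodd : p % 2 = 1 := hpP.eq_two_or_odd.resolve_left hp2
  have hhalf : (p - 1) / 2 = p / 2 := by omega
  have hne : ∀ a ∈ Finset.Icc 1 H, (a : ZMod p) ≠ 0 := by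
    intro a ha h
    rw [Finset.mem_Icc] at ha
    exact absurd (Nat.le_of_dvd (by omega) ((ZMod.natCast_eq_zero_iff a p).mp h)) (by omega)
  obtain ⟨g₀, hg₀⟩ := IsCyclic.exists_generator (α := (ZMod p)ˣ)
  have hord : orderOf (g₀ : ZMod p) = p - 1 := by
    rw [orderOf_units, orderOf_eq_card_of_forall_mem_zpowers hg₀, Nat.card_eq_fintype_card,
      ZMod.card_units]
  have hgpow : ∀ ℓ, ℓ.Prime → ℓ ∣ p - 1 → (g₀ : ZMod p) ^ ((p - 1) / ℓ) ≠ 1 := by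
    intro ℓ hℓ hd h
    have h1 := Nat.le_of_dvd (Nat.div_pos (Nat.le_of_dvd hp1 hd) hℓ.pos)
      (orderOf_dvd_of_pow_eq_one h)
    rw [hord] at h1
    exact absurd (Nat.div_lt_self hp1 hℓ.one_lt) (by omega)
  have h2dvd : 2 ∣ p - 1 := by omega
  obtain ⟨c, hc0, hc⟩ := ZMod.exists_sq_mul_cube_eq (Units.ne_zero g₀) hq0
    (hhalf ▸ hgpow 2 Nat.prime_two h2dvd) hq
  set A := (Finset.Icc 1 H).filter
    fun a : ℕ => (a : ZMod p) ^ ((p - 1) / k) = c ^ ((p - 1) / k) with hA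
  set bad : ℕ → Finset ℕ := fun ℓ =>
    A.filter fun a => ((a : ZMod p) ^ 2 * (q : ZMod p) ^ 3) ^ ((p - 1) / ℓ) = 1 with hbad
  have hbadcard : ∀ ℓ ∈ R, ((bad ℓ).card : ℝ) ≤ B ℓ := by
    intro ℓ hℓ
    obtain ⟨hℓp, hℓo, hℓd, hℓk⟩ := hR ℓ hℓ
    rcases (bad ℓ).eq_empty_or_nonempty with h | ⟨a₀, ha₀⟩
    · rw [h]; simpa using hB0 ℓ hℓ
    obtain ⟨m, hm, hmB⟩ := hB ℓ hℓ
    rw [hbad, Finset.mem_filter, hA, Finset.mem_filter] at ha₀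
    have ha₀0 := hne a₀ ha₀.1.1
    refine le_trans ?_ (hmB a₀ ha₀0)
    rw [Nat.cast_le]
    apply Finset.card_le_card
    intro a ha
    rw [hbad, Finset.mem_filter, hA, Finset.mem_filter] at ha
    have ha0 := hne a ha.1.1
    refine Finset.mem_filter.mpr ⟨ha.1.1, ?_⟩
    have hz0 : (a : ZMod p) / a₀ ≠ 0 := div_ne_zero ha0 ha₀0
    have hz1 : ((a : ZMod p) / a₀) ^ ((p - 1) / k) = 1 := by
      rw [div_pow, ha.1.2, ha₀.1.2, div_self (pow_ne_zero _ hc0)]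
    have hz2 : ((a : ZMod p) / a₀) ^ ((p - 1) / ℓ) = 1 := by
      apply ZMod.pow_div_eq_one_of_sq hz0 hℓo hℓd
      have : ((a : ZMod p) / a₀) ^ 2 =
          ((a : ZMod p) ^ 2 * (q : ZMod p) ^ 3) / ((a₀ : ZMod p) ^ 2 * (q : ZMod p) ^ 3) := by
        rw [div_pow, mul_div_mul_right _ _ (pow_ne_zero 3 hq0)]
      rw [this, div_pow, ha.2, ha₀.2, div_one]
    have hz : ((a : ZMod p) / a₀) ^ ((p - 1) / m) = 1 := by
      rcases hm with rfl | rfl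
      · exact pow_div_eq_one_of_coprime hk hℓd hℓk hz1 hz2
      · exact hz2
    rw [div_pow, div_eq_one_iff_eq (pow_ne_zero _ ha₀0)] at hz
    exact hz
  have hex : ∃ a ∈ A, ∀ ℓ ∈ R, a ∉ bad ℓ := by
    by_contra! hcon
    have hsub : A ⊆ R.biUnion bad := fun a ha => by
      obtain ⟨ℓ, hℓ, hab⟩ := hcon a ha
      exact Finset.mem_biUnion.mpr ⟨ℓ, hℓ, hab⟩
    have h1 : (A.card : ℝ) ≤ ∑ ℓ ∈ R, ((bad ℓ).card : ℝ) := by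
      exact_mod_cast (Finset.card_le_card hsub).trans Finset.card_biUnion_le
    have h2 := hN₀ c hc0
    have h3 := Finset.sum_le_sum hbadcard
    linarith
  obtain ⟨a, haA, hgood⟩ := hex
  have haA' := Finset.mem_filter.mp haA
  have ha0 := hne a haA'.1
  refine ⟨a, haA'.1, ?_⟩
  push_cast
  apply orderOf_eq_of_pow_and_pow_div_prime hp1
  · exact ZMod.pow_card_sub_one_eq_one (mul_ne_zero (pow_ne_zero _ ha0) (pow_ne_zero _ hq0))
  · intro ℓ hℓ hd h
    rcases hcover ℓ hℓ hd with rfl | hℓk | hℓR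
    · rw [hhalf, mul_pow, ← pow_mul, ← hhalf, Nat.mul_div_cancel' h2dvd,
        ZMod.pow_card_sub_one_eq_one ha0, one_mul, ← pow_mul, mul_comm, pow_mul, hhalf] at h
      rcases ZMod.pow_div_two_eq_neg_one_or_one p hq0 with h1 | h1
      · exact hq h1
      · rw [h1] at h
        apply hq
        rw [h1]
        exact (by ring : (-1 : ZMod p) = (-1) ^ 3).trans h
    · obtain ⟨u, rfl⟩ := hℓk
      obtain ⟨w, hw⟩ := hk
      have hu0 : 0 < u := Nat.pos_of_ne_zero (by rintro rfl; simp at hw; omega)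
      have e1 : (p - 1) / (ℓ * u) = w := by
        rw [hw, Nat.mul_div_cancel_left _ (Nat.mul_pos hℓ.pos hu0)]
      have e2 : (p - 1) / ℓ = w * u := by
        rw [hw, mul_assoc, Nat.mul_div_cancel_left _ hℓ.pos, mul_comm]
      have h1 := haA'.2
      rw [e1] at h1
      refine hgpow ℓ hℓ hd ?_
      rw [← hc, e2, pow_mul, mul_pow, ← pow_mul, mul_comm 2 w, pow_mul, ← h1, ← pow_mul _ w 2,
        mul_comm w 2, pow_mul, ← mul_pow, ← pow_mul, ← e2, h]
    · exact hgood ℓ hℓR (Finset.mem_filter.mpr ⟨haA, h⟩)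

theorem four_mul_card_le_of_pow_le {R : Finset ℕ} {n m L : ℕ} (hL : 4 ^ (4 * m) ≤ L)
    (hR : ∀ ℓ ∈ R, ℓ.Prime ∧ L < ℓ ∧ ℓ ∣ n) (hn0 : n ≠ 0) (hn : n < 4 ^ ((L + 1) * m)) :
    4 * R.card ≤ L := by
  have h1 : ∏ ℓ ∈ R, ℓ ∣ n :=
    Finset.prod_primes_dvd _ (fun ℓ hℓ => (hR ℓ hℓ).1.prime) fun ℓ hℓ => (hR ℓ hℓ).2.2
  have h2 : 4 ^ (4 * m * R.card) < 4 ^ ((L + 1) * m) := by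
    calc 4 ^ (4 * m * R.card) = (4 ^ (4 * m)) ^ R.card := by rw [pow_mul]
      _ ≤ L ^ R.card := Nat.pow_le_pow_left hL _
      _ = ∏ ℓ ∈ R, L := by rw [Finset.prod_const]
      _ ≤ ∏ ℓ ∈ R, ℓ := Finset.prod_le_prod' fun ℓ hℓ => (hR ℓ hℓ).2.1.le
      _ ≤ n := Nat.le_of_dvd (Nat.pos_of_ne_zero hn0) h1
      _ < _ := hn
  have h3 := (Nat.pow_lt_pow_iff_right (by norm_num)).mp h2
  have h4 : m * (4 * R.card) < m * (L + 1) := by linarith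
  exact Nat.lt_succ_iff.mp (lt_of_mul_lt_mul_left h4 (Nat.zero_le m))

theorem card_filter_pow_eq_le_div_sq {p : ℕ} [Fact p.Prime] {H ℓ : ℕ} {s : ℝ} (hs : 2 ≤ s)
    (hpH : p ≤ H ^ 4) (hH : H ^ 4 < p ^ 2) (hℓ0 : ℓ ∣ p - 1) (hℓ : s ^ 13 < ℓ)
    (hD : ∀ n, 1 ≤ n → n < p ^ 2 → (n.divisors.card : ℝ) ≤ s) (κ : ZMod p) :
    (((Finset.Icc 1 H).filter fun a : ℕ => (a : ZMod p) ^ ((p - 1) / ℓ) = κ).card : ℝ) ≤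
      H / s ^ 2 := by
  have hpP : p.Prime := Fact.out
  have hp1 : 0 < p - 1 := Nat.sub_pos_of_lt hpP.one_lt
  have hs0 : 0 < s := by linarith
  have hℓpos : 0 < ℓ := Nat.pos_of_dvd_of_pos hℓ0 hp1
  have he : 0 < (p - 1) / ℓ := Nat.div_pos (Nat.le_of_dvd hp1 hℓ0) hℓpos
  have h1 := card_filter_pow_eq_pow_four_le (D := ⌊s⌋₊) he hH
    (fun n h1 h2 => Nat.le_floor (hD n h1 h2)) κ
  set N := ((Finset.Icc 1 H).filter fun a : ℕ => (a : ZMod p) ^ ((p - 1) / ℓ) = κ).card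
  have hp0 : (0 : ℝ) < p := by exact_mod_cast hpP.pos
  have hℓR : (0 : ℝ) < ℓ := by exact_mod_cast hℓpos
  have he' : (((p - 1) / ℓ : ℕ) : ℝ) ≤ p / s ^ 13 := by
    calc (((p - 1) / ℓ : ℕ) : ℝ) ≤ ((p - 1 : ℕ) : ℝ) / ℓ := Nat.cast_div_le
      _ ≤ p / s ^ 13 := by
        gcongr
        exact Nat.sub_le _ _
  have hdiv : ((H ^ 4 / p + 1 : ℕ) : ℝ) ≤ 2 * H ^ 4 / p := by
    have h2 : ((H ^ 4 / p : ℕ) : ℝ) ≤ H ^ 4 / p := by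
      have := Nat.cast_div_le (α := ℝ) (m := H ^ 4) (n := p)
      push_cast at this
      exact this
    have h3 : (1 : ℝ) ≤ H ^ 4 / p := by
      rw [le_div_iff₀ hp0, one_mul]
      exact_mod_cast hpH
    push_cast
    have h4 : (2 : ℝ) * H ^ 4 / p = H ^ 4 / p + H ^ 4 / p := by ring
    rw [h4]
    exact add_le_add h2 h3
  have h5 : (N : ℝ) ^ 4 ≤ (H / s ^ 2) ^ 4 := by
    calc (N : ℝ) ^ 4 ≤ (⌊s⌋₊ : ℝ) ^ 4 * ((((p - 1) / ℓ : ℕ) : ℝ) * ((H ^ 4 / p + 1 : ℕ) : ℝ)) := by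
          exact_mod_cast h1
      _ ≤ s ^ 4 * (p / s ^ 13 * (2 * H ^ 4 / p)) := by
          gcongr
          exact Nat.floor_le hs0.le
      _ = 2 * (H ^ 4 / s ^ 9) := by field_simp
      _ ≤ s * (H ^ 4 / s ^ 9) := by gcongr
      _ = (H / s ^ 2) ^ 4 := by field_simp
  exact le_of_pow_le_pow_left₀ (by norm_num) (by positivity) h5

theorem exists_orderOf_sq_mul_cube_eq_of_bounds {p : ℕ} [Fact p.Prime] (hp2 : p ≠ 2)
    {H q L m : ℕ} {s : ℝ} (hq0 : (q : ZMod p) ≠ 0) (hq : (q : ZMod p) ^ (p / 2) ≠ 1)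
    (hL4 : 4 ≤ L) (hLm : 4 ^ (4 * m) ≤ L) (hLs : (4 : ℝ) ^ L ≤ s) (hp : p ≤ 4 ^ ((L + 1) * m))
    (hH1 : 0 < H) (hHp : H < p) (hpH : p ≤ H ^ 4) (hH : H ^ 4 < p ^ 2)
    (hD : ∀ n, 1 ≤ n → n < p ^ 2 → (n.divisors.card : ℝ) ≤ s)
    (hsum : ∀ χ : MulChar (ZMod p) ℂ, 2 ≤ orderOf χ → (orderOf χ : ℝ) ≤ s ^ 15 →
      ‖∑ n ∈ Finset.Icc 1 H, χ (n : ZMod p)‖ ≤ 3 * H / s ^ 15) :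
    ∃ a ∈ Finset.Icc 1 H, orderOf ((a ^ 2 * q ^ 3 : ℕ) : ZMod p) = p - 1 := by
  classical
  have hpP : p.Prime := Fact.out
  have hp1 : 0 < p - 1 := Nat.sub_pos_of_lt hpP.one_lt
  have hLsR : (L : ℝ) ≤ s := by
    refine le_trans ?_ hLs
    exact_mod_cast (Nat.lt_pow_self (by norm_num : 1 < 4)).le
  have hL4R : (4 : ℝ) ≤ L := by exact_mod_cast hL4
  have hs4 : 4 ≤ s := hL4R.trans hLsR
  have hs1 : 1 ≤ s := by linarith
  have hs0 : 0 < s := by linarith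
  set K := (p - 1).primeFactors.filter fun ℓ => ℓ ≠ 2 ∧ ℓ ≤ L with hK
  set R := (p - 1).primeFactors.filter fun ℓ => L < ℓ with hRdef
  set k := ∏ ℓ ∈ K, ℓ with hk
  have hKmem : ∀ ℓ ∈ K, ℓ.Prime ∧ ℓ ∣ p - 1 ∧ ℓ ≤ L := by
    intro ℓ hℓ
    rw [hK, Finset.mem_filter, Nat.mem_primeFactors] at hℓ
    exact ⟨hℓ.1.1, hℓ.1.2.1, hℓ.2.2⟩
  have hRmem : ∀ ℓ ∈ R, ℓ.Prime ∧ L < ℓ ∧ ℓ ∣ p - 1 := by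
    intro ℓ hℓ
    rw [hRdef, Finset.mem_filter, Nat.mem_primeFactors] at hℓ
    exact ⟨hℓ.1.1, hℓ.2, hℓ.1.2.1⟩
  have hkdvd : k ∣ p - 1 :=
    Finset.prod_primes_dvd _ (fun ℓ hℓ => (hKmem ℓ hℓ).1.prime) fun ℓ hℓ => (hKmem ℓ hℓ).2.1
  have hk0 : 0 < k := Nat.pos_of_dvd_of_pos hkdvd hp1
  have hks : (k : ℝ) ≤ s := by
    have h1 : k ≤ primorial L := by
      rw [primorial, hk]
      apply Finset.prod_le_prod_of_subset_of_one_le'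
      · intro ℓ hℓ
        obtain ⟨h1, -, h3⟩ := hKmem ℓ hℓ
        exact Finset.mem_filter.mpr ⟨Finset.mem_range.mpr (Nat.lt_succ_of_le h3), h1⟩
      · intro ℓ hℓ _
        exact (Finset.mem_filter.mp hℓ).2.one_le
    refine le_trans ?_ hLs
    exact_mod_cast h1.trans (primorial_le_four_pow L)
  have hcop : ∀ ℓ ∈ R, k.Coprime ℓ := by
    intro ℓ hℓ
    refine Nat.Coprime.prod_left fun r hr => ?_
    rw [Nat.coprime_primes (hKmem r hr).1 (hRmem ℓ hℓ).1]
    exact ((hKmem r hr).2.2.trans_lt (hRmem ℓ hℓ).2.1).ne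
  have hHR : (0 : ℝ) < H := by exact_mod_cast hH1
  have hkR : (0 : ℝ) < k := by exact_mod_cast hk0
  have hEs : 3 * (H : ℝ) / s ^ 15 ≤ H / s ^ 2 := by
    rw [div_le_div_iff₀ (by positivity) (by positivity)]
    have h13 : 3 ≤ s ^ 13 := by
      calc 3 ≤ s := by linarith
        _ ≤ s ^ 13 := le_self_pow₀ hs1 (by norm_num)
    calc 3 * (H : ℝ) * s ^ 2 ≤ s ^ 13 * H * s ^ 2 := by gcongr
      _ = H * s ^ 15 := by ring
  have hsk : (H : ℝ) / s ^ 2 ≤ H / k * (1 / s) := by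
    rw [mul_one_div, div_div, sq]
    gcongr
  have hequi : ∀ d, d ∣ p - 1 → (d : ℝ) ≤ s ^ 15 → ∀ c : ZMod p, c ≠ 0 →
      |(((Finset.Icc 1 H).filter
        fun a : ℕ => (a : ZMod p) ^ ((p - 1) / d) = c ^ ((p - 1) / d)).card : ℝ) - H / d| ≤
        3 * H / s ^ 15 := by
    intro d hd hds c hc
    refine abs_card_filter_pow_eq_sub_le (by positivity) (Nat.mul_div_cancel' hd) hc hHp ?_
    intro χ h1 h2
    exact hsum χ h1 (le_trans (by exact_mod_cast h2) hds)
  have hcardR : (4 : ℝ) * R.card ≤ L := by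
    exact_mod_cast four_mul_card_le_of_pow_le hLm hRmem hp1.ne' (by omega)
  refine exists_orderOf_sq_mul_cube_eq hp2 hHp hq0 hq hkdvd (R := R)
    (N₀ := H / k - 3 * H / s ^ 15) (B := fun _ => H / k * (1 / L) + H / s ^ 2)
    (fun ℓ hℓ => ⟨(hRmem ℓ hℓ).1, (hRmem ℓ hℓ).1.odd_of_ne_two (by
      have := (hRmem ℓ hℓ).2.1
      omega), (hRmem ℓ hℓ).2.2, hcop ℓ hℓ⟩) ?_ ?_ ?_ ?_ ?_
  · intro ℓ hℓ hd
    have hmem : ℓ ∈ (p - 1).primeFactors := Nat.mem_primeFactors.mpr ⟨hℓ, hd, hp1.ne'⟩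
    by_cases h2 : ℓ = 2
    · exact Or.inl h2
    rcases le_or_gt ℓ L with h | h
    · exact Or.inr (Or.inl (Finset.dvd_prod_of_mem _ (Finset.mem_filter.mpr ⟨hmem, h2, h⟩)))
    · exact Or.inr (Or.inr (Finset.mem_filter.mpr ⟨hmem, h⟩))
  · intro c hc
    have := (abs_le.mp (hequi k hkdvd (hks.trans (le_self_pow₀ hs1 (by norm_num))) c hc)).1
    linarith
  · intro ℓ _
    positivity
  · intro ℓ hℓ
    obtain ⟨hℓp, hℓL, hℓd⟩ := hRmem ℓ hℓ
    rcases le_or_gt (ℓ : ℝ) (s ^ 13) with h | h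
    · refine ⟨k * ℓ, Or.inl rfl, fun c hc => ?_⟩
      have hkl : ((k * ℓ : ℕ) : ℝ) ≤ s ^ 15 := by
        push_cast
        calc (k : ℝ) * ℓ ≤ s * s ^ 13 := by gcongr
          _ = s ^ 14 := by ring
          _ ≤ s ^ 15 := pow_le_pow_right₀ hs1 (by norm_num)
      have h1 := (abs_le.mp (hequi (k * ℓ) ((hcop ℓ hℓ).mul_dvd_of_dvd_of_dvd hkdvd hℓd)
        hkl c hc)).2
      have h2 : (H : ℝ) / ((k * ℓ : ℕ) : ℝ) ≤ H / k * (1 / L) := by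
        push_cast
        rw [mul_one_div, div_div]
        gcongr
      linarith
    · refine ⟨ℓ, Or.inr rfl, fun c _ => ?_⟩
      have h1 := card_filter_pow_eq_le_div_sq (by linarith) hpH hH hℓd h hD (c ^ ((p - 1) / ℓ))
      have h2 : (0 : ℝ) ≤ H / k * (1 / L) := by positivity
      linarith
  · rw [Finset.sum_const, nsmul_eq_mul]
    have hsL : (1 : ℝ) / s ≤ 1 / L := by gcongr
    have hL14 : (1 : ℝ) / L ≤ 1 / 4 := by gcongr
    have hHk : (0 : ℝ) < H / k := by positivity
    have h1 : (H : ℝ) / s ^ 2 ≤ H / k * (1 / L) :=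
      hsk.trans (mul_le_mul_of_nonneg_left hsL hHk.le)
    have h2 : H / k * (1 / (L : ℝ)) ≤ H / k * (1 / 4) := mul_le_mul_of_nonneg_left hL14 hHk.le
    have h3 : (R.card : ℝ) * (H / k * (1 / L) + H / s ^ 2) ≤ H / k * (1 / 2) := by
      calc (R.card : ℝ) * (H / k * (1 / L) + H / s ^ 2)
          ≤ (L / 4) * (H / k * (1 / L) + H / k * (1 / L)) := by
            gcongr
            linarith
        _ = H / k * (1 / 2) := by field_simp; ring
    linarith

theorem exists_roots_tower {p : ℝ} (hp : 0 ≤ p) :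
    ∃ s x Y : ℝ, 0 ≤ s ∧ x = s ^ 15 ∧ Y = x ^ 210 ∧ p = Y ^ 200 ∧ Y = p ^ ((200 : ℝ)⁻¹) := by
  have hY0 : (0 : ℝ) ≤ p ^ ((200 : ℝ)⁻¹) := Real.rpow_nonneg hp _
  have hx0 : (0 : ℝ) ≤ (p ^ ((200 : ℝ)⁻¹)) ^ ((210 : ℝ)⁻¹) := Real.rpow_nonneg hY0 _
  refine ⟨((p ^ ((200 : ℝ)⁻¹)) ^ ((210 : ℝ)⁻¹)) ^ ((15 : ℝ)⁻¹),
    (p ^ ((200 : ℝ)⁻¹)) ^ ((210 : ℝ)⁻¹), p ^ ((200 : ℝ)⁻¹), Real.rpow_nonneg hx0 _, ?_, ?_, ?_, rfl⟩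
  · exact (Real.rpow_inv_natCast_pow (n := 15) hx0 (by norm_num)).symm
  · exact (Real.rpow_inv_natCast_pow (n := 210) hY0 (by norm_num)).symm
  · exact (Real.rpow_inv_natCast_pow (n := 200) hp (by norm_num)).symm

theorem exists_card_divisors_le_root (m : ℕ) (hm : 0 < m) :
    ∃ s₀ : ℝ, ∀ (P : ℕ) (s : ℝ), s₀ ≤ s → 0 < s → (P : ℝ) = s ^ m →
      ∀ n, 1 ≤ n → n < P ^ 2 → (n.divisors.card : ℝ) ≤ s := by
  have hmR : (0 : ℝ) < m := by exact_mod_cast hm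
  obtain ⟨C, hC0, hC⟩ := exists_card_divisors_le_rpow (ε := 1 / (4 * m)) (by positivity)
  refine ⟨C ^ 2, fun P s hs hs0 hP n hn1 hn2 => ?_⟩
  have hn : (n : ℝ) ≤ s ^ (2 * m) := by
    rw [mul_comm, pow_mul, ← hP]
    exact_mod_cast hn2.le
  have hsq : √s * √s = s := Real.mul_self_sqrt hs0.le
  have hCs : C ≤ √s := Real.le_sqrt_of_sq_le hs
  calc (n.divisors.card : ℝ) ≤ C * (n : ℝ) ^ (1 / (4 * m) : ℝ) := hC n (by omega)
    _ ≤ √s * (s ^ (2 * m)) ^ (1 / (4 * m) : ℝ) := by gcongr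
    _ = √s * √s := by
      rw [← Real.rpow_natCast, ← Real.rpow_mul hs0.le, Real.sqrt_eq_rpow]
      congr 2
      push_cast
      field_simp
      norm_num
    _ = s := hsq

theorem exists_sq_mul_cube_primitive_root :
    ∃ P₀ : ℕ, ∀ p : ℕ, p.Prime → P₀ ≤ p → ∃ a q : ℕ, 0 < a ∧ 0 < q ∧
      orderOf ((a ^ 2 * q ^ 3 : ℕ) : ZMod p) = p - 1 ∧
      ((a ^ 2 * q ^ 3 : ℕ) : ℝ) ^ 10 ≤ (p : ℝ) ^ (2241 / 200 : ℝ) := by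
  obtain ⟨x₀, -, hx₀⟩ := exists_norm_sum_mulChar_le
  obtain ⟨m, hm⟩ : ∃ m : ℕ, m = 15 * 210 * 200 := ⟨_, rfl⟩
  have hm0 : 0 < m := by omega
  obtain ⟨s₁, hs₁⟩ := exists_card_divisors_le_root m hm0
  obtain ⟨Λ, hΛ⟩ : ∃ Λ : ℕ, Λ = 4 ^ (4 * m) + 4 := ⟨_, rfl⟩
  obtain ⟨s₀, hs₀⟩ : ∃ s₀ : ℝ, s₀ = max (max x₀ s₁) (max 4096 ((4 ^ Λ : ℕ) : ℝ)) := ⟨_, rfl⟩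
  refine ⟨⌈s₀ ^ m⌉₊, fun p hpP hp => ?_⟩
  have := Fact.mk hpP
  obtain ⟨s, x, Y, hs0, hxs, hYx, hpY, hYp⟩ := exists_roots_tower (p := p) (Nat.cast_nonneg p)
  have hpm : (p : ℝ) = s ^ m := by rw [hpY, hYx, hxs, ← pow_mul, ← pow_mul, hm]
  have hs₀s : s₀ ≤ s := by
    by_contra! hlt
    have h1 : s ^ m < s₀ ^ m := pow_lt_pow_left₀ hlt hs0 hm0.ne'
    have h2 := Nat.ceil_le.mp hp
    linarith
  have hsx₀ : x₀ ≤ s := le_trans (by rw [hs₀]; simp) hs₀s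
  have hss₁ : s₁ ≤ s := le_trans (by rw [hs₀]; simp) hs₀s
  have hs4096 : 4096 ≤ s := le_trans (by rw [hs₀]; simp) hs₀s
  have hsΛ : ((4 ^ Λ : ℕ) : ℝ) ≤ s := le_trans (by rw [hs₀]; simp) hs₀s
  have hs1 : 1 ≤ s := by linarith
  have hspos : 0 < s := by linarith
  have hsx : s ≤ x := by rw [hxs]; exact le_self_pow₀ hs1 (by norm_num)
  have hx1 : 1 ≤ x := hs1.trans hsx
  have hxY : x ≤ Y := by rw [hYx]; exact le_self_pow₀ hx1 (by norm_num)
  have hY4096 : 4096 ≤ Y := by linarith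
  have hY1 : 1 ≤ Y := by linarith
  have hY0 : 0 < Y := by linarith
  have hD := hs₁ p s hss₁ hspos hpm
  have hp2R : (2 : ℝ) < p := by
    rw [hpY]
    calc (2 : ℝ) < Y := by linarith
      _ ≤ Y ^ 200 := le_self_pow₀ hY1 (by norm_num)
  have hp2 : p ≠ 2 := by
    rintro rfl
    norm_num at hp2R
  have hpsq : p ≤ p ^ 2 := Nat.le_self_pow (by norm_num) p
  have hsum : ∀ χ : MulChar (ZMod p) ℂ, 2 ≤ orderOf χ → (orderOf χ : ℝ) ≤ x →
      ‖∑ n ∈ Finset.Icc 1 ⌊Y ^ 51⌋₊, χ (n : ZMod p)‖ ≤ 3 * ⌊Y ^ 51⌋₊ / x :=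
    hx₀ p x Y (hsx₀.trans hsx) hYx hpY
      fun n h1 h2 => (hD n h1 (h2.trans_le hpsq)).trans hsx
  set H := ⌊Y ^ 51⌋₊ with hH
  have hHle : (H : ℝ) ≤ Y ^ 51 := Nat.floor_le (by positivity)
  have hHge : Y ^ 50 ≤ H := by
    have h1 : Y ^ 51 < H + 1 := Nat.lt_floor_add_one _
    have h2 : (1 : ℝ) ≤ Y ^ 50 := one_le_pow₀ hY1
    have h3 : Y ^ 51 = Y * Y ^ 50 := by ring
    nlinarith
  have hH1 : 0 < H := by
    have h2 : (1 : ℝ) ≤ Y ^ 50 := one_le_pow₀ hY1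
    have : (0 : ℝ) < H := by linarith
    exact_mod_cast this
  have hHR : (0 : ℝ) < H := by exact_mod_cast hH1
  have hHp : H < p := by
    have h1 : (H : ℝ) < p := by
      rw [hpY]
      exact hHle.trans_lt (pow_lt_pow_right₀ (by linarith) (by norm_num))
    exact_mod_cast h1
  have hpH : p ≤ H ^ 4 := by
    have h1 : (p : ℝ) ≤ (H : ℝ) ^ 4 := by
      calc (p : ℝ) = (Y ^ 50) ^ 4 := by rw [hpY, ← pow_mul]
        _ ≤ _ := by gcongr
    exact_mod_cast h1
  have hH4 : H ^ 4 < p ^ 2 := by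
    have h1 : (H : ℝ) ^ 4 < (p : ℝ) ^ 2 := by
      calc (H : ℝ) ^ 4 ≤ (Y ^ 51) ^ 4 := by gcongr
        _ = Y ^ 204 := by rw [← pow_mul]
        _ < Y ^ 400 := pow_lt_pow_right₀ (by linarith) (by norm_num)
        _ = (p : ℝ) ^ 2 := by rw [hpY, ← pow_mul]
    exact_mod_cast h1
  have hlogH : 600 ≤ Nat.log 2 H := by
    apply Nat.le_log_of_pow_le (by norm_num)
    rw [← Nat.cast_le (α := ℝ)]
    refine le_trans (le_of_eq_of_le ?_ (pow_le_pow_left₀ (by norm_num) hY4096 50)) hHge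
    rw [show 600 = 12 * 50 from rfl, pow_mul, Nat.cast_pow]
    norm_num
  have hodd : p % 2 = 1 := hpP.eq_two_or_odd.resolve_left hp2
  obtain ⟨χ, hχ⟩ := MulChar.exists_mulChar_orderOf (ZMod p) (n := 2)
    (by rw [ZMod.card]; omega) (Complex.isPrimitiveRoot_exp 2 (by norm_num))
  obtain ⟨q, hqP, hqH, hqpow, hχq⟩ := χ.exists_prime_apply_ne_one hlogH (by
    refine (hsum χ hχ.ge (by rw [hχ]; push_cast; linarith)).trans_lt ?_
    rw [div_lt_div_iff₀ (by linarith) (by norm_num)]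
    nlinarith)
  have hq0 : (q : ZMod p) ≠ 0 := by
    intro h
    exact absurd (Nat.le_of_dvd hqP.pos ((ZMod.natCast_eq_zero_iff q p).mp h)) (by omega)
  have hq : (q : ZMod p) ^ (p / 2) ≠ 1 := by
    intro h
    apply hχq
    rw [← map_one χ]
    refine MulChar.apply_eq_of_pow_eq (e := p / 2) ?_ hq0 one_ne_zero (by rw [h, one_pow])
    rw [hχ]
    omega
  have hfloor : ⌊s⌋₊ ≠ 0 := (Nat.floor_pos.mpr hs1).ne'
  set L := Nat.log 4 ⌊s⌋₊ with hL
  have hLΛ : Λ ≤ L := Nat.le_log_of_pow_le (by norm_num) (Nat.le_floor hsΛ)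
  have hLs : (4 : ℝ) ^ L ≤ s := by
    refine le_trans ?_ (Nat.floor_le hs0)
    exact_mod_cast Nat.pow_log_le_self 4 hfloor
  have hsL : s ≤ 4 ^ (L + 1) := by
    have h1 : ⌊s⌋₊ + 1 ≤ 4 ^ (L + 1) := Nat.lt_pow_succ_log_self (by norm_num) _
    have h2 : ((⌊s⌋₊ + 1 : ℕ) : ℝ) ≤ 4 ^ (L + 1) := by exact_mod_cast h1
    push_cast at h2
    exact (Nat.lt_floor_add_one s).le.trans h2
  have hp4 : p ≤ 4 ^ ((L + 1) * m) := by
    have h1 : (p : ℝ) ≤ 4 ^ ((L + 1) * m) := by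
      rw [hpm, pow_mul]
      exact pow_le_pow_left₀ hs0 hsL m
    exact_mod_cast h1
  obtain ⟨a, ha, hord⟩ := exists_orderOf_sq_mul_cube_eq_of_bounds hp2 hq0 hq
    (le_trans (by rw [hΛ]; exact Nat.le_add_left _ _) hLΛ)
    (le_trans (by rw [hΛ]; exact Nat.le_add_right _ _) hLΛ) hLs hp4 hH1 hHp hpH hH4 hD (by rw [← hxs]; exact hsum)
  rw [Finset.mem_Icc] at ha
  refine ⟨a, q, ha.1, hqP.pos, hord, ?_⟩
  have hq10 : (q : ℝ) ^ 10 ≤ Y ^ 407 := by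
    have h1 : ((q : ℝ) ^ 10) ^ 51 ≤ (Y ^ 407) ^ 51 := by
      calc ((q : ℝ) ^ 10) ^ 51 = (q : ℝ) ^ 510 := by rw [← pow_mul]
        _ ≤ (H : ℝ) ^ 407 := by
          rw [← Nat.cast_pow, ← Nat.cast_pow]
          exact Nat.cast_le.mpr hqpow
        _ ≤ (Y ^ 51) ^ 407 := by gcongr
        _ = (Y ^ 407) ^ 51 := by rw [← pow_mul, ← pow_mul, mul_comm]
    exact le_of_pow_le_pow_left₀ (by norm_num) (by positivity) h1
  have ha10 : (a : ℝ) ≤ Y ^ 51 := le_trans (by exact_mod_cast ha.2) hHle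
  have hYpow : (p : ℝ) ^ (2241 / 200 : ℝ) = Y ^ 2241 := by
    rw [hYp, ← Real.rpow_natCast, ← Real.rpow_mul (Nat.cast_nonneg p)]
    congr 1
    norm_num
  rw [hYpow]
  calc ((a ^ 2 * q ^ 3 : ℕ) : ℝ) ^ 10 = (a : ℝ) ^ 20 * ((q : ℝ) ^ 10) ^ 3 := by push_cast; ring
    _ ≤ (Y ^ 51) ^ 20 * (Y ^ 407) ^ 3 := by gcongr
    _ = Y ^ 2241 := by rw [← pow_mul, ← pow_mul, ← pow_add]

theorem squarefull_sq_mul_cube (a q : ℕ) : Squarefull (a ^ 2 * q ^ 3) := by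
  intro r hr hd
  rcases (hr.dvd_mul).mp hd with h | h
  · exact (pow_dvd_pow_of_dvd (hr.dvd_of_dvd_pow h) 2).mul_right _
  · exact ((pow_dvd_pow_of_dvd (hr.dvd_of_dvd_pow h) 2).trans
      (pow_dvd_pow q (by norm_num))).mul_left _

theorem exists_squarefull_primitive_root {p : ℕ} (hp : p.Prime) :
    ∃ g : ℕ, 1 ≤ g ∧ Squarefull g ∧ orderOf (g : ZMod p) = p - 1 ∧ g ≤ p ^ p := by
  have := Fact.mk hp
  obtain ⟨g₀, hg₀⟩ := IsCyclic.exists_generator (α := (ZMod p)ˣ)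
  set v := (g₀ : ZMod p).val with hv
  have hv0 : 0 < v := Nat.pos_of_ne_zero fun h => g₀.ne_zero ((ZMod.val_eq_zero _).mp h)
  refine ⟨v ^ p, Nat.one_le_pow _ _ hv0, ?_, ?_, Nat.pow_le_pow_left (ZMod.val_lt _).le p⟩
  · intro r hr hd
    exact (pow_dvd_pow_of_dvd (hr.dvd_of_dvd_pow hd) 2).trans (pow_dvd_pow v hp.two_le)
  · rw [Nat.cast_pow, ZMod.pow_card, hv, ZMod.natCast_zmod_val, orderOf_units,
      orderOf_eq_card_of_forall_mem_zpowers hg₀, Nat.card_eq_fintype_card, ZMod.card_units]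

theorem le_two_thirds_add_three_div : (2241 / 2000 : ℝ) ≤ 2 / 3 + 3 / (4 * √(Real.exp 1)) := by
  have h1 : √(Real.exp 1) ≤ 1.6488 := by
    rw [Real.sqrt_le_left (by norm_num)]
    have := Real.exp_one_lt_d9
    norm_num at this ⊢
    linarith
  have h2 : 3 / (4 * 1.6488) ≤ 3 / (4 * √(Real.exp 1)) := by gcongr
  norm_num at h2 ⊢
  linarith

/-- Corollary 1: there is a square-full primitive root mod `p` of size at most
`C * p^(2/3 + 3/(4√e)) * (log p)^7 * 2^(6 ω(p-1))`. -/
theorem least_squarefull_primitive_root_bound :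
    ∃ C : ℝ, 0 < C ∧ ∀ p : ℕ, p.Prime → Odd p →
      ∃ g : ℕ, 1 ≤ g ∧ Squarefull g ∧ orderOf (g : ZMod p) = p - 1 ∧
        (g : ℝ) ≤ C * (p : ℝ) ^ (2/3 + 3 / (4 * Real.sqrt (Real.exp 1)))
          * (Real.log p) ^ 7 * 2 ^ (6 * (p - 1).primeFactors.card) := by
  obtain ⟨P₀, hP₀⟩ := exists_sq_mul_cube_primitive_root
  have hC1 : (1 : ℝ) ≤ 1 + (P₀ : ℝ) ^ P₀ := le_add_of_nonneg_right (by positivity)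
  refine ⟨1 + (P₀ : ℝ) ^ P₀, by positivity, fun p hp hodd => ?_⟩
  have hp3 : 3 ≤ p := by
    have h2 := hp.two_le
    rcases hodd with ⟨k, rfl⟩
    omega
  have hp3R : (3 : ℝ) ≤ p := by exact_mod_cast hp3
  have hp1 : (1 : ℝ) ≤ p := by linarith
  set θ := (2 / 3 + 3 / (4 * Real.sqrt (Real.exp 1)) : ℝ) with hθ
  have hθ' : (2241 / 2000 : ℝ) ≤ θ := le_two_thirds_add_three_div
  have hlog : 1 ≤ Real.log p := by
    rw [Real.le_log_iff_exp_le (by linarith)]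
    have := Real.exp_one_lt_d9
    norm_num at this
    linarith
  have hlog7 : 1 ≤ Real.log p ^ 7 := one_le_pow₀ hlog
  have htwo : (1 : ℝ) ≤ 2 ^ (6 * (p - 1).primeFactors.card) := one_le_pow₀ (by norm_num)
  have hpθ : 1 ≤ (p : ℝ) ^ θ := Real.one_le_rpow hp1 (by linarith)
  have hred : ∀ g : ℝ, g ≤ (1 + (P₀ : ℝ) ^ P₀) * (p : ℝ) ^ θ →
      g ≤ (1 + (P₀ : ℝ) ^ P₀) * (p : ℝ) ^ θ * Real.log p ^ 7 *
        2 ^ (6 * (p - 1).primeFactors.card) := by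
    intro g hg
    refine hg.trans ?_
    rw [mul_assoc _ (Real.log p ^ 7)]
    exact le_mul_of_one_le_right (by positivity) (one_le_mul_of_one_le_of_one_le hlog7 htwo)
  rcases le_or_gt P₀ p with hlarge | hsmall
  · obtain ⟨a, q, ha, hq, hord, hle⟩ := hP₀ p hp hlarge
    refine ⟨a ^ 2 * q ^ 3, Nat.succ_le_of_lt (by positivity), squarefull_sq_mul_cube a q, hord,
      hred _ ?_⟩
    have h1 : ((a ^ 2 * q ^ 3 : ℕ) : ℝ) ^ 10 ≤ ((p : ℝ) ^ θ) ^ 10 := by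
      refine hle.trans ?_
      rw [← Real.rpow_natCast, ← Real.rpow_mul (by linarith)]
      refine Real.rpow_le_rpow_of_exponent_le hp1 ?_
      push_cast
      linarith
    exact (le_of_pow_le_pow_left₀ (by norm_num) (by positivity) h1).trans
      (le_mul_of_one_le_left (by positivity) hC1)
  · obtain ⟨g, hg1, hgs, hord, hle⟩ := exists_squarefull_primitive_root hp
    refine ⟨g, hg1, hgs, hord, hred _ ?_⟩
    have h1 : p ^ p ≤ P₀ ^ P₀ :=
      (Nat.pow_le_pow_left hsmall.le p).trans (Nat.pow_le_pow_right (by omega) hsmall.le)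
    have h2 : (g : ℝ) ≤ (P₀ : ℝ) ^ P₀ := by exact_mod_cast hle.trans h1
    calc (g : ℝ) ≤ 1 + (P₀ : ℝ) ^ P₀ := by linarith
      _ ≤ _ := le_mul_of_one_le_right (by positivity) hpθ
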